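/- arXiv:1611.03564 — 2 statements merged into one kernel-verified Lean document; each statement's English description precedes it below -/
import Mathlib

section
/- Let c₁' > 0 be a constant, let f ∈ L¹(ℍ¹, dv) satisfy f ≥ 0, set α := ∫_{ℍ¹} f dv, and assume 0 ≤ α < c₁'. Let C ∈ ℝ and suppose u : ℍ¹ → ℝ satisfies u(x) = (1/c₁') ∫_{ℍ¹} log( ρ(y)/ρ(y⁻¹x) ) f(y) dv(y) + C, the integral being absolutely convergent for almost every x (the 'normal metric' representation with total Q'-curvature mass α). Then e^{4u} is an A₁ weight on ℍ¹: there is a constant C₀, depending only on α/c₁', such that for every Korányi ball B and almost every x ∈ B, (1/|B|) ∫_B e^{4u(y)} dv(y) ≤ C₀ e^{4u(x)}. -/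
open MeasureTheory Real

noncomputable section

/-- The Heisenberg group `ℍ¹` as `ℝ³` with coordinates `(x, y, t)`. -/
abbrev Heis : Type := ℝ × ℝ × ℝ

/-- Group law `(z,t)·(z',t') = (z+z', t+t'+2 Im(z ⬝ conj z'))`. -/
def Hmul (p q : Heis) : Heis :=
  (p.1 + q.1, p.2.1 + q.2.1, p.2.2 + q.2.2 + 2 * (p.2.1 * q.1 - p.1 * q.2.1))

/-- Group inverse `(z,t)⁻¹ = (-z,-t)`. -/
def Hinv (p : Heis) : Heis := (-p.1, -p.2.1, -p.2.2)

/-- Korányi norm `ρ(z,t) = (|z|⁴ + t²)^(1/4)`. -/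
def rho (p : Heis) : ℝ := ((p.1 ^ 2 + p.2.1 ^ 2) ^ 2 + p.2.2 ^ 2) ^ ((1 : ℝ) / 4)

/-- Korányi ball `B(p,r) = {q : ρ(p⁻¹ q) < r}`. -/
def Kball (p : Heis) (r : ℝ) : Set Heis := {q | rho (Hmul (Hinv p) q) < r}

/-- The left-invariant vector field `X = ∂ₓ + 2y ∂_t` acting on a function. -/
def Xd (f : Heis → ℝ) (p : Heis) : ℝ := fderiv ℝ f p (1, 0, 2 * p.2.1)

/-- The left-invariant vector field `Y = ∂_y − 2x ∂_t` acting on a function. -/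
def Yd (f : Heis → ℝ) (p : Heis) : ℝ := fderiv ℝ f p (0, 1, -(2 * p.1))

/-- The vector field `T = ∂_t`. -/
def Td (f : Heis → ℝ) (p : Heis) : ℝ := fderiv ℝ f p (0, 0, 1)

/-- Sub-Laplacian `Δ_b = X² + Y²`. -/
def subLap (f : Heis → ℝ) : Heis → ℝ := fun p => Xd (Xd f) p + Yd (Yd f) p

/-- Squared length of the horizontal gradient: `|∇_b f|² = (Xf)² + (Yf)²`. -/
def gradb2 (f : Heis → ℝ) (p : Heis) : ℝ := (Xd f p) ^ 2 + (Yd f p) ^ 2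

lemma continuous_rho : Continuous rho := by
  unfold rho
  exact Continuous.rpow_const (by fun_prop) (fun _ => Or.inr (by norm_num))

lemma continuous_Hmul : Continuous (fun q : Heis × Heis => Hmul (Hinv q.1) q.2) := by
  unfold Hmul Hinv
  fun_prop

lemma rho_nonneg (p : Heis) : 0 ≤ rho p := by
  unfold rho; positivity

lemma rho_pow_four (p : Heis) : rho p ^ 4 = (p.1 ^ 2 + p.2.1 ^ 2) ^ 2 + p.2.2 ^ 2 := by
  unfold rho
  rw [← Real.rpow_natCast, ← Real.rpow_mul (by positivity)]
  norm_num

lemma rho_Hinv (p : Heis) : rho (Hinv p) = rho p := by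
  simp [rho, Hinv]

lemma eq_zero_of_rho_eq_zero {p : Heis} (h : rho p = 0) : p = 0 := by
  have h4 := rho_pow_four p
  rw [h] at h4
  have hz : p.1 ^ 2 + p.2.1 ^ 2 = 0 := by
    nlinarith [sq_nonneg p.2.2, sq_nonneg (p.1 ^ 2 + p.2.1 ^ 2)]
  have h1 : p.1 = 0 := by nlinarith [sq_nonneg p.2.1]
  have h2 : p.2.1 = 0 := by nlinarith [sq_nonneg p.1]
  have h3 : p.2.2 = 0 := by
    rw [hz] at h4
    nlinarith
  ext <;> simp [h1, h2, h3]

lemma rho_sq (p : Heis) : rho p ^ 2 = ‖(⟨p.1 ^ 2 + p.2.1 ^ 2, p.2.2⟩ : ℂ)‖ := by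
  have h : (rho p ^ 2) ^ 2 = ‖(⟨p.1 ^ 2 + p.2.1 ^ 2, p.2.2⟩ : ℂ)‖ ^ 2 := by
    rw [Complex.sq_norm, Complex.normSq_mk, ← pow_mul, rho_pow_four]
    ring
  exact (sq_eq_sq₀ (by positivity) (norm_nonneg _)).1 h

lemma norm_horizontal_le_rho (p : Heis) : ‖(⟨p.1, p.2.1⟩ : ℂ)‖ ≤ rho p := by
  refine le_of_sq_le_sq ?_ (rho_nonneg p)
  rw [Complex.sq_norm, Complex.normSq_mk, rho_sq]
  refine le_trans (le_of_eq ?_) (Complex.abs_re_le_norm _)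
  rw [abs_of_nonneg (by positivity)]
  ring

/-- Cygan's triangle inequality for the Korányi norm. -/
lemma rho_Hmul_le (p q : Heis) : rho (Hmul p q) ≤ rho p + rho q := by
  have key : (⟨(Hmul p q).1 ^ 2 + (Hmul p q).2.1 ^ 2, (Hmul p q).2.2⟩ : ℂ)
      = ⟨p.1 ^ 2 + p.2.1 ^ 2, p.2.2⟩ + ⟨q.1 ^ 2 + q.2.1 ^ 2, q.2.2⟩
        + 2 * (⟨p.1, p.2.1⟩ * (starRingEnd ℂ) ⟨q.1, q.2.1⟩) := by
    apply Complex.ext <;> simp [Hmul] <;> ring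
  refine le_of_sq_le_sq ?_ (add_nonneg (rho_nonneg p) (rho_nonneg q))
  rw [rho_sq, key]
  refine (norm_add₃_le).trans ?_
  rw [← rho_sq, ← rho_sq, norm_mul, norm_mul, Complex.norm_conj, Complex.norm_two]
  have := mul_le_mul (norm_horizontal_le_rho p) (norm_horizontal_le_rho q)
    (norm_nonneg _) (rho_nonneg p)
  nlinarith

/-- The left-invariant Korányi distance. -/
def Kdist (p q : Heis) : ℝ := rho (Hmul (Hinv p) q)

lemma Kdist_nonneg (p q : Heis) : 0 ≤ Kdist p q := rho_nonneg _

lemma Kdist_comm (p q : Heis) : Kdist p q = Kdist q p := by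
  unfold Kdist
  rw [← rho_Hinv]
  congr 1
  simp only [Hinv, Hmul, Prod.mk.injEq]
  refine ⟨?_, ?_, ?_⟩ <;> ring

lemma Kdist_triangle (p q w : Heis) : Kdist p w ≤ Kdist p q + Kdist q w := by
  unfold Kdist
  refine le_trans (le_of_eq ?_) (rho_Hmul_le _ _)
  congr 1
  simp only [Hinv, Hmul, Prod.mk.injEq]
  refine ⟨?_, ?_, ?_⟩ <;> ring

lemma eq_of_Kdist_eq_zero {p q : Heis} (h : Kdist p q = 0) : p = q := by
  have h0 := eq_zero_of_rho_eq_zero h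
  simp only [Hinv, Hmul, Prod.ext_iff, Prod.fst_zero, Prod.snd_zero] at h0
  obtain ⟨h1, h2, h3⟩ := h0
  have e1 : q.1 = p.1 := by linarith
  have e2 : q.2.1 = p.2.1 := by linarith
  rw [e1, e2] at h3
  refine Prod.ext e1.symm (Prod.ext e2.symm ?_)
  linarith

lemma continuous_Kdist : Continuous (fun q : Heis × Heis => Kdist q.1 q.2) :=
  continuous_rho.comp continuous_Hmul

lemma measurableSet_Kball (p : Heis) (r : ℝ) : MeasurableSet (Kball p r) :=
  (isOpen_lt (continuous_Kdist.comp (Continuous.prodMk_right p)) continuous_const).measurableSet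

lemma measurePreserving_Hmul (p : Heis) : MeasurePreserving (Hmul p) volume volume := by
  have h : ∀ a : ℝ, MeasurePreserving
      (fun v : ℝ × ℝ => (p.2.1 + v.1, p.2.2 + v.2 + 2 * (p.2.1 * a - p.1 * v.1)))
      volume volume := by
    intro a
    refine MeasurePreserving.skew_product (f := fun b : ℝ => p.2.1 + b)
      (g := fun b t : ℝ => p.2.2 + t + 2 * (p.2.1 * a - p.1 * b))
      (measurePreserving_add_left volume p.2.1) (by fun_prop) (ae_of_all _ fun b => ?_)
    have := (measurePreserving_add_right (volume : Measure ℝ)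
      (p.2.2 + 2 * (p.2.1 * a - p.1 * b))).map_eq
    rw [← this]
    congr 1
    ext t
    ring
  exact MeasurePreserving.skew_product (f := fun a : ℝ => p.1 + a)
    (g := fun (a : ℝ) (v : ℝ × ℝ) =>
      (p.2.1 + v.1, p.2.2 + v.2 + 2 * (p.2.1 * a - p.1 * v.1)))
    (measurePreserving_add_left volume p.1) (by fun_prop) (ae_of_all _ fun a => (h a).map_eq)

lemma Kball_eq_preimage (p : Heis) (r : ℝ) : Kball p r = Hmul (Hinv p) ⁻¹' {q | rho q < r} := rfl

lemma measurableSet_rho_lt (r : ℝ) : MeasurableSet {q | rho q < r} :=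
  (isOpen_lt continuous_rho continuous_const).measurableSet

lemma volume_Kball (p : Heis) (r : ℝ) : volume (Kball p r) = volume {q | rho q < r} := by
  rw [Kball_eq_preimage]
  exact (measurePreserving_Hmul _).measure_preimage (measurableSet_rho_lt r).nullMeasurableSet

lemma rho_lt_subset_box (R : ℝ) :
    {q | rho q < R} ⊆ Set.Ioo (-R) R ×ˢ (Set.Ioo (-R) R ×ˢ Set.Ioo (-R ^ 2) (R ^ 2)) := by
  intro q hq
  have hq : rho q < R := hq
  have h0 := rho_nonneg q
  have h2 : rho q ^ 2 < R ^ 2 := by nlinarith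
  have hz := norm_horizontal_le_rho q
  have h1 := (Complex.abs_re_le_norm ⟨q.1, q.2.1⟩).trans hz
  have h3 := (Complex.abs_im_le_norm ⟨q.1, q.2.1⟩).trans hz
  have h4 := Complex.abs_im_le_norm ⟨q.1 ^ 2 + q.2.1 ^ 2, q.2.2⟩
  rw [← rho_sq] at h4
  exact ⟨abs_lt.1 (h1.trans_lt hq), abs_lt.1 (h3.trans_lt hq), abs_lt.1 (h4.trans_lt h2)⟩

lemma box_subset_rho_lt {r : ℝ} (hr : 0 < r) :
    Set.Ioo (-(r / 2)) (r / 2) ×ˢ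
      (Set.Ioo (-(r / 2)) (r / 2) ×ˢ Set.Ioo (-(r ^ 2 / 2)) (r ^ 2 / 2)) ⊆ {q | rho q < r} := by
  rintro ⟨a, b, t⟩ ⟨ha, hb, ht⟩
  simp only at ha hb ht
  have h1 : a ^ 2 ≤ (r / 2) ^ 2 := sq_le_sq' ha.1.le ha.2.le
  have h2 : b ^ 2 ≤ (r / 2) ^ 2 := sq_le_sq' hb.1.le hb.2.le
  have h3 : t ^ 2 ≤ (r ^ 2 / 2) ^ 2 := sq_le_sq' ht.1.le ht.2.le
  refine lt_of_pow_lt_pow_left₀ 4 hr.le ?_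
  rw [rho_pow_four]
  have h4 : (a ^ 2 + b ^ 2) ^ 2 ≤ (r ^ 2 / 2) ^ 2 :=
    pow_le_pow_left₀ (by positivity) (by nlinarith) 2
  have : 0 < r ^ 4 := by positivity
  simp only
  nlinarith

lemma le_volume_Kball (p : Heis) {r : ℝ} (hr : 0 < r) :
    ENNReal.ofReal (r ^ 4) ≤ volume (Kball p r) := by
  rw [volume_Kball]
  refine le_trans (le_of_eq ?_) (measure_mono (box_subset_rho_lt hr))
  simp only [Measure.volume_eq_prod, Measure.prod_prod, Real.volume_Ioo]
  rw [← ENNReal.ofReal_mul (by linarith), ← ENNReal.ofReal_mul (by linarith)]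
  ring_nf

lemma volume_Kball_lt_top (p : Heis) (r : ℝ) : volume (Kball p r) < ⊤ := by
  rw [volume_Kball]
  refine (measure_mono (rho_lt_subset_box r)).trans_lt ?_
  simp only [Measure.volume_eq_prod, Measure.prod_prod, Real.volume_Ioo]
  exact ENNReal.mul_lt_top ENNReal.ofReal_lt_top
    (ENNReal.mul_lt_top ENNReal.ofReal_lt_top ENNReal.ofReal_lt_top)

lemma lintegral_Icc_inv_rpow_le {R β : ℝ} (hR : 0 < R) (hβ1 : β < 1) :
    ∫⁻ a in Set.Icc 0 R, (ENNReal.ofReal |a| ^ β)⁻¹ ≤ ENNReal.ofReal (R ^ (1 - β) / (1 - β)) := by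
  have hint : IntervalIntegrable (fun a : ℝ => a ^ (-β)) volume 0 R :=
    intervalIntegral.intervalIntegrable_rpow' (by linarith)
  rw [← Measure.restrict_congr_set Ioc_ae_eq_Icc]
  calc ∫⁻ a in Set.Ioc 0 R, (ENNReal.ofReal |a| ^ β)⁻¹
      = ∫⁻ a in Set.Ioc 0 R, ENNReal.ofReal (a ^ (-β)) := by
        refine setLIntegral_congr_fun measurableSet_Ioc fun a ha => ?_
        rw [abs_of_pos ha.1, ← ENNReal.rpow_neg, ENNReal.ofReal_rpow_of_pos ha.1]
    _ = ENNReal.ofReal (∫ a in Set.Ioc 0 R, a ^ (-β)) := by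
        refine (ofReal_integral_eq_lintegral_ofReal
          ((intervalIntegrable_iff_integrableOn_Ioc_of_le hR.le).1 hint) ?_).symm
        filter_upwards [ae_restrict_mem measurableSet_Ioc] with a ha
        exact Real.rpow_nonneg ha.1.le _
    _ ≤ _ := by
        rw [← intervalIntegral.integral_of_le hR.le, integral_rpow (Or.inl (by linarith)),
          Real.zero_rpow (by linarith), sub_zero, neg_add_eq_sub]

lemma lintegral_Ioo_inv_rpow_le {R β : ℝ} (hR : 0 < R) (hβ1 : β < 1) :
    ∫⁻ a in Set.Ioo (-R) R, (ENNReal.ofReal |a| ^ β)⁻¹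
      ≤ ENNReal.ofReal (2 * (R ^ (1 - β) / (1 - β))) := by
  have hneg : ∫⁻ a in Set.Icc (-R) 0, (ENNReal.ofReal |a| ^ β)⁻¹
      = ∫⁻ a in Set.Icc 0 R, (ENNReal.ofReal |a| ^ β)⁻¹ := by
    have h := (Measure.measurePreserving_neg (volume : Measure ℝ)).setLIntegral_comp_preimage
      (s := Set.Icc 0 R) measurableSet_Icc (f := fun a => (ENNReal.ofReal |a| ^ β)⁻¹)
      (by fun_prop)
    simpa using h
  have hsub : Set.Ioo (-R) R ⊆ Set.Icc (-R) 0 ∪ Set.Icc 0 R := by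
    intro a ha
    rcases le_total a 0 with h | h
    · exact Or.inl ⟨ha.1.le, h⟩
    · exact Or.inr ⟨h, ha.2.le⟩
  refine (lintegral_mono_set hsub).trans ((lintegral_union_le _ _ _).trans ?_)
  have hnn : 0 ≤ R ^ (1 - β) / (1 - β) := div_nonneg (by positivity) (by linarith)
  rw [hneg, two_mul, ENNReal.ofReal_add hnn hnn]
  exact add_le_add (lintegral_Icc_inv_rpow_le hR hβ1) (lintegral_Icc_inv_rpow_le hR hβ1)

lemma abs_mul_abs_mul_abs_le_rho_pow (w : Heis) :
    |w.1| * (|w.2.1| * |w.2.2|) ≤ rho w ^ 4 := by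
  have h0 := rho_nonneg w
  have hz := norm_horizontal_le_rho w
  have h1 := (Complex.abs_re_le_norm ⟨w.1, w.2.1⟩).trans hz
  have h3 := (Complex.abs_im_le_norm ⟨w.1, w.2.1⟩).trans hz
  have h4 := Complex.abs_im_le_norm ⟨w.1 ^ 2 + w.2.1 ^ 2, w.2.2⟩
  rw [← rho_sq] at h4
  calc |w.1| * (|w.2.1| * |w.2.2|) ≤ rho w * (rho w * rho w ^ 2) := by
        gcongr
    _ = rho w ^ 4 := by ring

lemma inv_rho_rpow_le {β : ℝ} (hβ0 : 0 ≤ β) (w : Heis) :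
    (ENNReal.ofReal (rho w) ^ (4 * β))⁻¹ ≤ (ENNReal.ofReal |w.1| ^ β)⁻¹ *
      ((ENNReal.ofReal |w.2.1| ^ β)⁻¹ * (ENNReal.ofReal |w.2.2| ^ β)⁻¹) := by
  have htop : ∀ a : ℝ, ENNReal.ofReal |a| ^ β ≠ ⊤ := fun a =>
    ENNReal.rpow_ne_top_of_nonneg hβ0 ENNReal.ofReal_ne_top
  rw [← ENNReal.mul_inv (Or.inr (htop _)) (Or.inl (htop _)),
    ← ENNReal.mul_inv (Or.inr (ENNReal.mul_ne_top (htop _) (htop _))) (Or.inl (htop _)),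
    ENNReal.inv_le_inv, ← ENNReal.mul_rpow_of_nonneg _ _ hβ0,
    ← ENNReal.mul_rpow_of_nonneg _ _ hβ0, ← ENNReal.ofReal_mul (abs_nonneg _),
    ← ENNReal.ofReal_mul (abs_nonneg _), ENNReal.rpow_mul]
  refine ENNReal.rpow_le_rpow ?_ hβ0
  rw [show (4 : ℝ) = ((4 : ℕ) : ℝ) by norm_num, ENNReal.rpow_natCast,
    ← ENNReal.ofReal_pow (rho_nonneg w)]
  exact ENNReal.ofReal_le_ofReal (abs_mul_abs_mul_abs_le_rho_pow w)

lemma lintegral_inv_rho_rpow_le {R β : ℝ} (hR : 0 < R) (hβ0 : 0 ≤ β) (hβ1 : β < 1) :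
    ∫⁻ w in {w | rho w < R}, (ENNReal.ofReal (rho w) ^ (4 * β))⁻¹
      ≤ ENNReal.ofReal (8 * R ^ (4 - 4 * β) / (1 - β) ^ 3) := by
  have hm : Measurable fun a : ℝ => (ENNReal.ofReal |a| ^ β)⁻¹ := by fun_prop
  have h1 : 0 < 1 - β := by linarith
  calc ∫⁻ w in {w | rho w < R}, (ENNReal.ofReal (rho w) ^ (4 * β))⁻¹
      ≤ ∫⁻ w : Heis in Set.Ioo (-R) R ×ˢ (Set.Ioo (-R) R ×ˢ Set.Ioo (-R ^ 2) (R ^ 2)),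
          (ENNReal.ofReal |w.1| ^ β)⁻¹ *
          ((ENNReal.ofReal |w.2.1| ^ β)⁻¹ * (ENNReal.ofReal |w.2.2| ^ β)⁻¹) :=
        (lintegral_mono_set (rho_lt_subset_box R)).trans
          (lintegral_mono fun w => inv_rho_rpow_le hβ0 w)
    _ = (∫⁻ a in Set.Ioo (-R) R, (ENNReal.ofReal |a| ^ β)⁻¹) *
          ((∫⁻ a in Set.Ioo (-R) R, (ENNReal.ofReal |a| ^ β)⁻¹) *
            ∫⁻ a in Set.Ioo (-R ^ 2) (R ^ 2), (ENNReal.ofReal |a| ^ β)⁻¹) := by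
        rw [Measure.volume_eq_prod, Measure.volume_eq_prod, ← Measure.prod_restrict,
          ← Measure.prod_restrict]
        rw [lintegral_prod_mul (f := fun a : ℝ => (ENNReal.ofReal |a| ^ β)⁻¹)
            (g := fun v : ℝ × ℝ => (ENNReal.ofReal |v.1| ^ β)⁻¹ * (ENNReal.ofReal |v.2| ^ β)⁻¹)
            hm.aemeasurable (by fun_prop),
          lintegral_prod_mul (f := fun a : ℝ => (ENNReal.ofReal |a| ^ β)⁻¹)
            (g := fun a : ℝ => (ENNReal.ofReal |a| ^ β)⁻¹) hm.aemeasurable hm.aemeasurable]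
    _ ≤ ENNReal.ofReal (2 * (R ^ (1 - β) / (1 - β))) *
          (ENNReal.ofReal (2 * (R ^ (1 - β) / (1 - β))) *
            ENNReal.ofReal (2 * ((R ^ 2) ^ (1 - β) / (1 - β)))) := by
        gcongr
        · exact lintegral_Ioo_inv_rpow_le hR hβ1
        · exact lintegral_Ioo_inv_rpow_le hR hβ1
        · exact lintegral_Ioo_inv_rpow_le (by positivity) hβ1
    _ = ENNReal.ofReal (8 * R ^ (4 - 4 * β) / (1 - β) ^ 3) := by
        rw [← ENNReal.ofReal_mul (by positivity), ← ENNReal.ofReal_mul (by positivity)]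
        congr 1
        have e2 : (R ^ 2) ^ (1 - β) = R ^ (1 - β) * R ^ (1 - β) := by
          rw [sq, Real.mul_rpow hR.le hR.le]
        have e4 : R ^ (4 - 4 * β) = (R ^ (1 - β)) ^ 4 := by
          rw [← Real.rpow_natCast, ← Real.rpow_mul hR.le]
          congr 1
          push_cast
          ring
        rw [e2, e4]
        field_simp
        ring

lemma measurable_Kdist_left (y : Heis) : Measurable (Kdist y) :=
  (continuous_Kdist.comp (Continuous.prodMk_right y)).measurable

/-- The negative powers of the Korányi distance to a point, up to (but excluding) the homogeneous
dimension, are `A₁` weights, uniformly in that point. -/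
lemma lintegral_Kdist_ratio_le {β r : ℝ} (hβ0 : 0 ≤ β) (hβ1 : β < 1) (hr : 0 < r)
    {p x : Heis} (hx : x ∈ Kball p r) (y : Heis) :
    ∫⁻ w in Kball p r, ENNReal.ofReal (Kdist y x) ^ (4 * β) *
        (ENNReal.ofReal (Kdist y w) ^ (4 * β))⁻¹
      ≤ ENNReal.ofReal (648 / (1 - β) ^ 3) * volume (Kball p r) := by
  have h1 : 0 < 1 - β := by linarith
  have hx' : Kdist p x < r := hx
  have hyx := Kdist_triangle y p x
  have h4β : 0 ≤ 4 * β := by linarith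
  have hc : (81 : ℝ) ≤ 648 / (1 - β) ^ 3 := by
    rw [le_div_iff₀ (by positivity)]
    have : (1 - β) ^ 3 ≤ 1 := pow_le_one₀ h1.le (by linarith)
    linarith
  rcases le_or_gt (2 * r) (Kdist y p) with hD | hD
  · have hpt : ∀ w ∈ Kball p r, ENNReal.ofReal (Kdist y x) ^ (4 * β) *
        (ENNReal.ofReal (Kdist y w) ^ (4 * β))⁻¹ ≤ ENNReal.ofReal (648 / (1 - β) ^ 3) := by
      intro w hw
      have hw' : Kdist p w < r := hw
      have hyw := Kdist_triangle y w p
      rw [Kdist_comm w p] at hyw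
      have h3 : Kdist y x ≤ 3 * Kdist y w := by linarith
      rw [← div_eq_mul_inv]
      refine ENNReal.div_le_of_le_mul ?_
      calc ENNReal.ofReal (Kdist y x) ^ (4 * β)
          ≤ ENNReal.ofReal (3 * Kdist y w) ^ (4 * β) :=
            ENNReal.rpow_le_rpow (ENNReal.ofReal_le_ofReal h3) h4β
        _ = ENNReal.ofReal (3 ^ (4 * β)) * ENNReal.ofReal (Kdist y w) ^ (4 * β) := by
            rw [ENNReal.ofReal_mul (by norm_num), ENNReal.mul_rpow_of_nonneg _ _ h4β,
              ENNReal.ofReal_rpow_of_pos (by norm_num)]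
        _ ≤ _ := by
            gcongr
            refine le_trans ?_ hc
            calc (3 : ℝ) ^ (4 * β) ≤ 3 ^ (4 : ℝ) :=
                  Real.rpow_le_rpow_of_exponent_le (by norm_num) (by linarith)
              _ = 81 := by norm_num
    refine (setLIntegral_mono' (measurableSet_Kball p r) hpt).trans ?_
    rw [setLIntegral_const]
  · have hsub : Kball p r ⊆ Kball y (3 * r) := by
      intro w hw
      have hw' : Kdist p w < r := hw
      have := Kdist_triangle y p w
      exact (by linarith : Kdist y w < 3 * r)
    have hm : Measurable fun w => (ENNReal.ofReal (rho w) ^ (4 * β))⁻¹ := by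
      have := continuous_rho.measurable
      fun_prop
    have hint : ∫⁻ w in Kball y (3 * r), (ENNReal.ofReal (Kdist y w) ^ (4 * β))⁻¹
        ≤ ENNReal.ofReal (8 * (3 * r) ^ (4 - 4 * β) / (1 - β) ^ 3) := by
      refine le_trans (le_of_eq ?_)
        (lintegral_inv_rho_rpow_le (by positivity : 0 < 3 * r) hβ0 hβ1)
      exact (measurePreserving_Hmul (Hinv y)).setLIntegral_comp_preimage
        (measurableSet_rho_lt (3 * r)) hm
    have hmy := measurable_Kdist_left y
    rw [lintegral_const_mul _ (by fun_prop)]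
    calc ENNReal.ofReal (Kdist y x) ^ (4 * β) *
          ∫⁻ w in Kball p r, (ENNReal.ofReal (Kdist y w) ^ (4 * β))⁻¹
        ≤ ENNReal.ofReal (3 * r) ^ (4 * β) *
          ENNReal.ofReal (8 * (3 * r) ^ (4 - 4 * β) / (1 - β) ^ 3) := by
          gcongr
          · linarith
          · exact (lintegral_mono_set hsub).trans hint
      _ = ENNReal.ofReal (648 / (1 - β) ^ 3) * ENNReal.ofReal (r ^ 4) := by
          rw [ENNReal.ofReal_rpow_of_pos (by positivity), ← ENNReal.ofReal_mul (by positivity),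
            ← ENNReal.ofReal_mul (by positivity)]
          congr 1
          have e : (3 * r) ^ (4 * β) * (3 * r) ^ (4 - 4 * β) = 81 * r ^ 4 := by
            rw [← Real.rpow_add (by positivity), add_sub_cancel,
              show (4 : ℝ) = ((4 : ℕ) : ℝ) by norm_num, Real.rpow_natCast]
            ring
          calc _ = 8 * ((3 * r) ^ (4 * β) * (3 * r) ^ (4 - 4 * β)) / (1 - β) ^ 3 := by ring
            _ = _ := by rw [e]; ring
      _ ≤ _ := by
          gcongr
          exact le_volume_Kball p hr

/-- Jensen's inequality for the exponential with respect to a density `f`. -/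
lemma ofReal_exp_integral_le_lintegral {α : Type*} [MeasurableSpace α] {μ : Measure α}
    {f g : α → ℝ} (hf : Integrable f μ) (hf0 : ∀ y, 0 ≤ f y) (hpos : 0 < ∫ y, f y ∂μ)
    (hg : Integrable (fun y => g y * f y) μ) :
    ENNReal.ofReal (∫ y, f y ∂μ) *
        ENNReal.ofReal (Real.exp ((∫ y, g y * f y ∂μ) / ∫ y, f y ∂μ))
      ≤ ∫⁻ y, ENNReal.ofReal (Real.exp (g y)) * ENNReal.ofReal (f y) ∂μ := by
  set a := ∫ y, f y ∂μ with ha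
  set m := (∫ y, g y * f y ∂μ) / a with hm
  set h : α → ℝ := fun y => Real.exp m * ((1 - m) * f y + g y * f y) with hh
  have hhint : Integrable h μ := ((hf.const_mul _).add hg).const_mul _
  have hval : ∫ y, h y ∂μ = a * Real.exp m := by
    rw [hh, integral_const_mul, integral_add (hf.const_mul _) hg, integral_const_mul, ← ha,
      show ∫ y, g y * f y ∂μ = m * a by rw [hm]; field_simp]
    ring
  have hle : ∀ y, h y ≤ Real.exp (g y) * f y := by
    intro y
    have h1 := Real.add_one_le_exp (g y - m)
    have h2 : Real.exp (g y) = Real.exp m * Real.exp (g y - m) := by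
      rw [← Real.exp_add]; congr 1; ring
    calc h y = Real.exp m * ((g y - m + 1) * f y) := by rw [hh]; ring
      _ ≤ Real.exp m * (Real.exp (g y - m) * f y) := by
          gcongr
          exact hf0 y
      _ = _ := by rw [h2]; ring
  rw [← ENNReal.ofReal_mul hpos.le, ← hval]
  calc ENNReal.ofReal (∫ y, h y ∂μ)
      ≤ ∫⁻ y, ENNReal.ofReal (h y) ∂μ := by
        rw [integral_eq_lintegral_pos_part_sub_lintegral_neg_part hhint]
        refine (ENNReal.ofReal_le_ofReal (sub_le_self _ ENNReal.toReal_nonneg)).trans ?_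
        exact ENNReal.ofReal_toReal_le
    _ ≤ _ := by
        refine lintegral_mono fun y => ?_
        rw [← ENNReal.ofReal_mul (Real.exp_pos _).le]
        exact ENNReal.ofReal_le_ofReal (hle y)

/-- The conformal factor at `w` is controlled by the one at `x` and the average of the kernel
`(d(y, x) / d(y, w)) ^ (4β)` with respect to `f`. -/
lemma ofReal_exp_normal_metric_le {c : ℝ} (hc : 0 < c) {f : Heis → ℝ} (hf : Integrable f volume)
    (hf0 : ∀ y, 0 ≤ f y) (hpos : 0 < ∫ y, f y) {C : ℝ} {u : Heis → ℝ} {x w : Heis}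
    (hx : Integrable (fun y => Real.log (rho y / Kdist y x) * f y) volume ∧
      u x = (1 / c) * (∫ y, Real.log (rho y / Kdist y x) * f y) + C)
    (hw : Integrable (fun y => Real.log (rho y / Kdist y w) * f y) volume ∧
      u w = (1 / c) * (∫ y, Real.log (rho y / Kdist y w) * f y) + C) :
    ENNReal.ofReal (∫ y, f y) * ENNReal.ofReal (Real.exp (4 * u w))
      ≤ ENNReal.ofReal (Real.exp (4 * u x)) *
        ∫⁻ y, ENNReal.ofReal (Kdist y x) ^ (4 * ((∫ y, f y) / c)) *
          (ENNReal.ofReal (Kdist y w) ^ (4 * ((∫ y, f y) / c)))⁻¹ * ENNReal.ofReal (f y) := by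
  set a := ∫ y, f y with ha
  set s := 4 * (a / c) with hs
  have hs0 : 0 ≤ s := by positivity
  set g : Heis → ℝ := fun y =>
    s * (Real.log (rho y / Kdist y w) - Real.log (rho y / Kdist y x)) with hg
  have hgf : (fun y => g y * f y) = fun y => s * (Real.log (rho y / Kdist y w) * f y
      - Real.log (rho y / Kdist y x) * f y) := by
    funext y
    rw [hg]
    ring
  have hgint : Integrable (fun y => g y * f y) volume := by
    rw [hgf]
    exact (hw.1.sub hx.1).const_mul _
  have hval : (∫ y, g y * f y) / a = 4 * u w - 4 * u x := by
    rw [hgf, integral_const_mul, integral_sub hw.1 hx.1, hw.2, hx.2, hs]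
    field_simp
    ring
  have hJ := ofReal_exp_integral_le_lintegral hf hf0 hpos hgint
  rw [← ha, hval] at hJ
  have hae : ∀ᵐ y : Heis, ENNReal.ofReal (Real.exp (g y)) =
      ENNReal.ofReal (Kdist y x) ^ s * (ENNReal.ofReal (Kdist y w) ^ s)⁻¹ := by
    have : NullSingletonClass (volume : Measure Heis) := by
      rw [Measure.volume_eq_prod]
      infer_instance
    filter_upwards [Measure.ae_ne volume (0 : Heis), Measure.ae_ne volume x,
      Measure.ae_ne volume w] with y h0 h1 h2
    have p0 : 0 < rho y :=
      (rho_nonneg y).lt_of_ne fun h => h0 (eq_zero_of_rho_eq_zero h.symm)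
    have p1 : 0 < Kdist y x :=
      (Kdist_nonneg y x).lt_of_ne fun h => h1 (eq_of_Kdist_eq_zero h.symm)
    have p2 : 0 < Kdist y w :=
      (Kdist_nonneg y w).lt_of_ne fun h => h2 (eq_of_Kdist_eq_zero h.symm)
    rw [← ENNReal.rpow_neg, ENNReal.ofReal_rpow_of_pos p1, ENNReal.ofReal_rpow_of_pos p2,
      ← ENNReal.ofReal_mul (by positivity), Real.rpow_def_of_pos p1, Real.rpow_def_of_pos p2,
      ← Real.exp_add, hg]
    congr 2
    simp only
    rw [Real.log_div p0.ne' p2.ne', Real.log_div p0.ne' p1.ne']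
    ring
  have hcongr : ∫⁻ y, ENNReal.ofReal (Real.exp (g y)) * ENNReal.ofReal (f y) =
      ∫⁻ y, ENNReal.ofReal (Kdist y x) ^ s *
        (ENNReal.ofReal (Kdist y w) ^ s)⁻¹ * ENNReal.ofReal (f y) :=
    lintegral_congr_ae (hae.mono fun y hy => by simp only [hy])
  rw [← hcongr]
  calc ENNReal.ofReal a * ENNReal.ofReal (Real.exp (4 * u w))
      = ENNReal.ofReal (Real.exp (4 * u x)) *
        (ENNReal.ofReal a * ENNReal.ofReal (Real.exp (4 * u w - 4 * u x))) := by
        rw [mul_left_comm, ← ENNReal.ofReal_mul (Real.exp_pos _).le, ← Real.exp_add,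
          add_sub_cancel]
    _ ≤ _ := by gcongr

lemma lintegral_exp_normal_metric_le {c : ℝ} (hc : 0 < c) {f : Heis → ℝ}
    (hf : Integrable f volume) (hf0 : ∀ y, 0 ≤ f y) (hlt : ∫ y, f y < c) {C : ℝ} {u : Heis → ℝ}
    (hu : ∀ᵐ x : Heis, Integrable (fun y => Real.log (rho y / Kdist y x) * f y) volume ∧
      u x = (1 / c) * (∫ y, Real.log (rho y / Kdist y x) * f y) + C)
    {p : Heis} {r : ℝ} (hr : 0 < r) {x : Heis} (hxB : x ∈ Kball p r)
    (hx : Integrable (fun y => Real.log (rho y / Kdist y x) * f y) volume ∧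
      u x = (1 / c) * (∫ y, Real.log (rho y / Kdist y x) * f y) + C) :
    ∫⁻ w in Kball p r, ENNReal.ofReal (Real.exp (4 * u w))
      ≤ ENNReal.ofReal (Real.exp (4 * u x)) *
        (ENNReal.ofReal (648 / (1 - (∫ y, f y) / c) ^ 3) * volume (Kball p r)) := by
  set a := ∫ y, f y with ha
  have ha0 : 0 ≤ a := integral_nonneg hf0
  have hβ0 : 0 ≤ a / c := by positivity
  have hβ1 : a / c < 1 := (div_lt_one hc).2 hlt
  rcases ha0.eq_or_lt with h0 | hpos
  · have hfz : f =ᵐ[volume] 0 := (integral_eq_zero_iff_of_nonneg hf0 hf).1 h0.symm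
    have hz : ∀ v : Heis, ∫ y, Real.log (rho y / Kdist y v) * f y = 0 := fun v =>
      integral_eq_zero_of_ae (hfz.mono fun y hy => by simp [hy])
    have huw : ∀ᵐ w ∂volume.restrict (Kball p r),
        ENNReal.ofReal (Real.exp (4 * u w)) = ENNReal.ofReal (Real.exp (4 * u x)) := by
      filter_upwards [ae_restrict_of_ae hu] with w hw
      rw [hw.2, hx.2, hz, hz]
    rw [lintegral_congr_ae huw, setLIntegral_const, ← h0]
    gcongr
    refine le_mul_of_one_le_left zero_le ?_
    rw [ENNReal.one_le_ofReal]
    norm_num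
  · set s := 4 * (a / c) with hs
    have hane : ENNReal.ofReal a ≠ 0 := (ENNReal.ofReal_pos.2 hpos).ne'
    rw [← ENNReal.mul_le_mul_iff_right hane ENNReal.ofReal_ne_top,
      ← lintegral_const_mul' _ _ ENNReal.ofReal_ne_top]
    have hmeas : AEMeasurable (Function.uncurry fun w y : Heis =>
        ENNReal.ofReal (Kdist y x) ^ s * (ENNReal.ofReal (Kdist y w) ^ s)⁻¹ *
          ENNReal.ofReal (f y)) ((volume.restrict (Kball p r)).prod volume) := by
      have h1 : Measurable fun q : Heis × Heis => Kdist q.2 x :=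
        (continuous_Kdist.comp (continuous_snd.prodMk continuous_const)).measurable
      have h2 : Measurable fun q : Heis × Heis => Kdist q.2 q.1 :=
        (continuous_Kdist.comp continuous_swap).measurable
      have h3 : AEMeasurable (fun q : Heis × Heis => ENNReal.ofReal (f q.2))
          ((volume.restrict (Kball p r)).prod volume) :=
        hf.aestronglyMeasurable.aemeasurable.ennreal_ofReal.comp_snd
      refine AEMeasurable.mul (Measurable.aemeasurable ?_) h3
      fun_prop
    calc ∫⁻ w in Kball p r, ENNReal.ofReal a * ENNReal.ofReal (Real.exp (4 * u w))
        ≤ ∫⁻ w in Kball p r, ENNReal.ofReal (Real.exp (4 * u x)) *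
            ∫⁻ y, ENNReal.ofReal (Kdist y x) ^ s * (ENNReal.ofReal (Kdist y w) ^ s)⁻¹ *
              ENNReal.ofReal (f y) :=
          lintegral_mono_ae ((ae_restrict_of_ae hu).mono fun w hw =>
            ofReal_exp_normal_metric_le hc hf hf0 hpos hx hw)
      _ = ENNReal.ofReal (Real.exp (4 * u x)) * ∫⁻ y, (∫⁻ w in Kball p r,
            ENNReal.ofReal (Kdist y x) ^ s * (ENNReal.ofReal (Kdist y w) ^ s)⁻¹) *
              ENNReal.ofReal (f y) := by
          rw [lintegral_const_mul' _ _ ENNReal.ofReal_ne_top, lintegral_lintegral_swap hmeas]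
          congr 1
          refine lintegral_congr fun y => ?_
          rw [lintegral_mul_const' _ _ ENNReal.ofReal_ne_top]
      _ ≤ ENNReal.ofReal (Real.exp (4 * u x)) * ∫⁻ y,
            (ENNReal.ofReal (648 / (1 - a / c) ^ 3) * volume (Kball p r)) *
              ENNReal.ofReal (f y) := by
          gcongr with y
          exact lintegral_Kdist_ratio_le hβ0 hβ1 hr hxB y
      _ = _ := by
          rw [lintegral_const_mul' _ _
              (ENNReal.mul_ne_top ENNReal.ofReal_ne_top (volume_Kball_lt_top p r).ne),
            ← ofReal_integral_eq_lintegral_ofReal hf (ae_of_all _ hf0), ← ha]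
          ring

/-- if `u` has the normal-metric integral representation with total
`Q'`-mass `α = ∫ f < c₁'`, then `e^{4u}` is an `A₁` weight on `ℍ¹`, with `A₁` constant
depending only on `α / c₁'`. -/
theorem A1_of_normal_metric :
    ∃ C₀ : ℝ → ℝ,
      ∀ (c₁' : ℝ), 0 < c₁' →
      ∀ f : Heis → ℝ, Integrable f volume → (∀ y, 0 ≤ f y) →
      0 ≤ (∫ y, f y) → (∫ y, f y) < c₁' →
      ∀ (C : ℝ) (u : Heis → ℝ),
        (∀ᵐ x : Heis,
          Integrable (fun y => Real.log (rho y / rho (Hmul (Hinv y) x)) * f y) volume ∧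
          u x = (1 / c₁') * (∫ y, Real.log (rho y / rho (Hmul (Hinv y) x)) * f y) + C) →
      ∀ (p : Heis) (r : ℝ), 0 < r →
        ∀ᵐ x ∂(volume.restrict (Kball p r)),
          (∫ y in Kball p r, Real.exp (4 * u y)) / (volume (Kball p r)).toReal
            ≤ C₀ ((∫ y, f y) / c₁') * Real.exp (4 * u x) := by
  refine ⟨fun s => 648 / (1 - s) ^ 3, fun c hc f hf hf0 _ hlt C u hu p r hr => ?_⟩
  have hV : 0 < volume (Kball p r) :=
    (ENNReal.ofReal_pos.2 (by positivity)).trans_le (le_volume_Kball p hr)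
  filter_upwards [ae_restrict_of_ae hu, ae_restrict_mem (measurableSet_Kball p r)] with x hx hxB
  have key := lintegral_exp_normal_metric_le hc hf hf0 hlt hu hr hxB hx
  rw [div_le_iff₀ (ENNReal.toReal_pos hV.ne' (volume_Kball_lt_top p r).ne)]
  have hβ1 : (∫ y, f y) / c < 1 := (div_lt_one hc).2 hlt
  have hC : 0 ≤ 648 / (1 - (∫ y, f y) / c) ^ 3 :=
    div_nonneg (by norm_num) (pow_nonneg (by linarith) 3)
  have htop : ENNReal.ofReal (Real.exp (4 * u x)) *
      (ENNReal.ofReal (648 / (1 - (∫ y, f y) / c) ^ 3) * volume (Kball p r)) ≠ ⊤ :=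
    ENNReal.mul_ne_top ENNReal.ofReal_ne_top
      (ENNReal.mul_ne_top ENNReal.ofReal_ne_top (volume_Kball_lt_top p r).ne)
  calc ∫ y in Kball p r, Real.exp (4 * u y)
      ≤ (∫⁻ y in Kball p r, ENNReal.ofReal ‖Real.exp (4 * u y)‖).toReal :=
        (Real.le_norm_self _).trans (norm_integral_le_lintegral_norm _)
    _ ≤ (ENNReal.ofReal (Real.exp (4 * u x)) *
          (ENNReal.ofReal (648 / (1 - (∫ y, f y) / c) ^ 3) * volume (Kball p r))).toReal := by
        refine ENNReal.toReal_mono htop ?_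
        simpa only [Real.norm_eq_abs, Real.abs_exp] using key
    _ = _ := by
        rw [ENNReal.toReal_mul, ENNReal.toReal_mul, ENNReal.toReal_ofReal (Real.exp_pos _).le,
          ENNReal.toReal_ofReal hC]
        ring

end
end

section
/- Let u : ℝ³ → ℝ be smooth and satisfy: (i) Δ_b²u + 16T²u = 0 (the equation satisfied by CR-pluriharmonic functions on ℍ¹); (ii) Δ_b²u ∈ L¹(ℍ¹, dv); (iii) there is a compact set K with −Δ_b u ≥ |∇_b u|² on ℝ³∖K (nonnegative Webster scalar curvature of e^{u}θ near infinity); (iv) the conformal metric e^{u}θ is complete, i.e. for every locally Lipschitz horizontal curve γ : [0,∞) → ℝ³ with γ'(s) = a(s)X(γ(s)) + b(s)Y(γ(s)) a.e. which eventually leaves every compact set, ∫₀^∞ e^{u(γ(s))} √(a(s)²+b(s)²) ds = ∞. Let κ ∈ ℝ and set v(x) := κ ∫_{ℍ¹} log( ρ(y)/ρ(y⁻¹x) ) Δ_b²u(y) dv(y), and assume that w := u − v satisfies Δ_b²w = 0 and that Tw is constant (as holds when κ is the fundamental-solution constant of the operator P' = 2Δ_b² on pluriharmonic functions). Then w is constant;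 that is, u(x) = κ ∫_{ℍ¹} log( ρ(y)/ρ(y⁻¹x) ) Δ_b²u(y) dv(y) + C for some constant C (the metric e^{u}θ is normal). -/
open MeasureTheory Real

noncomputable section

section PlaneLiouville
open Set Filter Topology

theorem integral_energy_cutoff_le {P Q : ℝ × ℝ → ℝ} (hP : ContDiff ℝ 1 P) (hQ : ContDiff ℝ 1 Q)
    (h : ∀ z, fderiv ℝ P z (1, 0) + fderiv ℝ Q z (0, 1) + (P z ^ 2 + Q z ^ 2) ≤ 0)
    {φ : ℝ × ℝ → ℝ} (hφ : ContDiff ℝ 1 φ) (hc : HasCompactSupport φ) :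
    ∫ z, φ z ^ 2 * (P z ^ 2 + Q z ^ 2) ≤
      ∫ z, 2 * φ z * (fderiv ℝ φ z (1, 0) * P z + fderiv ℝ φ z (0, 1) * Q z) := by
  have hd : Differentiable ℝ φ := hφ.differentiable one_ne_zero
  have hφ2 : ContDiff ℝ 1 (fun z => φ z ^ 2) := hφ.pow 2
  have hc2 : HasCompactSupport (fun z => φ z ^ 2) := by
    have := hc.mul_right (f' := φ)
    simp_rw [pow_two]; exact this
  have key : ∀ (R : ℝ × ℝ → ℝ) (e : ℝ × ℝ), ContDiff ℝ 1 R →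
      Integrable (fun z => φ z ^ 2 * fderiv ℝ R z e) ∧
      Integrable (fun z => 2 * φ z * (fderiv ℝ φ z e * R z)) ∧
      ∫ z, φ z ^ 2 * fderiv ℝ R z e = - ∫ z, 2 * φ z * (fderiv ℝ φ z e * R z) := by
    intro R e hR
    have e1 : ∀ z, fderiv ℝ (fun z => φ z ^ 2) z e * R z = 2 * φ z * (fderiv ℝ φ z e * R z) := by
      intro z
      rw [fderiv_fun_pow 2 (hd z)]
      simp; ring
    have cR : Continuous fun z => fderiv ℝ R z e := (hR.continuous_fderiv one_ne_zero).clm_apply continuous_const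
    have cφ : Continuous fun z => fderiv ℝ φ z e := (hφ.continuous_fderiv one_ne_zero).clm_apply continuous_const
    have i1 : Integrable (fun z => φ z ^ 2 * fderiv ℝ R z e) :=
      (hφ2.continuous.mul cR).integrable_of_hasCompactSupport hc2.mul_right
    have i2 : Integrable (fun z => 2 * φ z * (fderiv ℝ φ z e * R z)) := by
      refine Continuous.integrable_of_hasCompactSupport ?_ ?_
      · exact (continuous_const.mul hφ.continuous).mul (cφ.mul hR.continuous)
      · exact (hc.mul_left (f := fun _ => (2 : ℝ))).mul_right
    refine ⟨i1, i2, ?_⟩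
    rw [integral_mul_fderiv_eq_neg_fderiv_mul_of_integrable _ i1]
    · simp_rw [e1]
    · exact (hφ2.continuous.mul hR.continuous).integrable_of_hasCompactSupport hc2.mul_right
    · exact fun z _ => hφ2.differentiable one_ne_zero z
    · exact fun z _ => hR.differentiable one_ne_zero z
    · simp_rw [e1]; exact i2
  obtain ⟨a1, a2, a3⟩ := key P (1, 0) hP
  obtain ⟨b1, b2, b3⟩ := key Q (0, 1) hQ
  have : ∫ z, φ z ^ 2 * (P z ^ 2 + Q z ^ 2) ≤
      ∫ z, -(φ z ^ 2 * fderiv ℝ P z (1, 0)) - φ z ^ 2 * fderiv ℝ Q z (0, 1) := by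
    refine integral_mono ?_ (a1.neg.sub b1) ?_
    · refine Continuous.integrable_of_hasCompactSupport ?_ hc2.mul_right
      exact hφ2.continuous.mul ((hP.continuous.pow 2).add (hQ.continuous.pow 2))
    · intro z
      have := mul_nonneg (sq_nonneg (φ z)) (neg_nonneg.2 (h z))
      simp only
      linarith
  refine this.trans_eq ?_
  rw [integral_sub (f := fun z => -(φ z ^ 2 * fderiv ℝ P z (1, 0))) a1.neg b1, integral_neg, a3, b3]
  simp_rw [mul_add]
  rw [integral_add a2 b2]
  ring

/-- A planar vector field `(P, Q)` with `div (P, Q) + |(P, Q)|² ≤ 0` everywhere vanishes. -/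
theorem eq_zero_of_div_add_sq_le {P Q : ℝ × ℝ → ℝ} (hP : ContDiff ℝ 1 P) (hQ : ContDiff ℝ 1 Q)
    (h : ∀ z, fderiv ℝ P z (1, 0) + fderiv ℝ Q z (0, 1) + (P z ^ 2 + Q z ^ 2) ≤ 0) (z : ℝ × ℝ) :
    P z = 0 ∧ Q z = 0 := by
  set E : ℝ × ℝ → ℝ := fun z => P z ^ 2 + Q z ^ 2 with hE
  have cE : Continuous E := (hP.continuous.pow 2).add (hQ.continuous.pow 2)
  have E0 : ∀ z, 0 ≤ E z := fun z => by positivity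
  have iE : ∀ R : ℝ, IntegrableOn E (Metric.closedBall 0 R) := fun R =>
    cE.continuousOn.integrableOn_compact (isCompact_closedBall 0 R)
  set S : ℝ → ℝ := fun R => ∫ z in Metric.closedBall 0 R, E z with hS
  have S0 : ∀ R, 0 ≤ S R := fun R => integral_nonneg E0
  have Smono : Monotone S := fun a b hab =>
    setIntegral_mono_set (iE b) (Eventually.of_forall E0)
      (Metric.closedBall_subset_closedBall hab).eventuallyLE
  let f : ContDiffBump (0 : ℝ × ℝ) := ⟨1, 2, one_pos, one_lt_two⟩
  obtain ⟨C, hC⟩ : ∃ C, ∀ x, ‖fderiv ℝ f x‖ ≤ C := by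
    have : HasCompactSupport (fderiv ℝ f) := f.hasCompactSupport.fderiv ℝ
    exact this.exists_bound_of_continuous ((f.contDiff (n := 1)).continuous_fderiv one_ne_zero)
  have C0 : 0 ≤ C := (norm_nonneg _).trans (hC 0)
  have vol : ∀ R : ℝ, 0 < R →
      volume.real (Metric.closedBall (0 : ℝ × ℝ) (2 * R)) = 16 * R ^ 2 := by
    intro R hR
    rw [← closedBall_prod_same, Measure.volume_eq_prod, measureReal_prod_prod]
    simp only [Measure.real, Real.volume_closedBall]
    rw [ENNReal.toReal_ofReal (by positivity)]
    ring
  have key : ∀ R : ℝ, 0 < R → S R ≤ 128 * C ^ 2 ∧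
      ∀ l : ℝ, 0 < l → S R ≤ l * (S (2 * R) - S R) + 32 * C ^ 2 / l := by
    intro R hR
    set φ : ℝ × ℝ → ℝ := fun z => f (R⁻¹ • z) with hφ
    have cφ : ContDiff ℝ 1 φ := f.contDiff.comp (contDiff_const_smul _)
    have φ1 : ∀ z ∈ Metric.closedBall (0 : ℝ × ℝ) R, φ z = 1 := by
      intro z hz
      refine f.one_of_mem_closedBall ?_
      rw [mem_closedBall_zero_iff] at hz ⊢
      rw [norm_smul, norm_inv, Real.norm_of_nonneg hR.le]
      change R⁻¹ * ‖z‖ ≤ 1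
      rw [inv_mul_le_iff₀ hR]; linarith
    have φout : ∀ z ∉ Metric.closedBall (0 : ℝ × ℝ) (2 * R), φ z = 0 := by
      intro z hz
      refine f.zero_of_le_dist ?_
      rw [mem_closedBall_zero_iff, not_le] at hz
      rw [dist_zero_right, norm_smul, norm_inv, Real.norm_of_nonneg hR.le]
      change 2 ≤ R⁻¹ * ‖z‖
      rw [le_inv_mul_iff₀ hR]; linarith
    have hc : HasCompactSupport φ :=
      HasCompactSupport.intro (isCompact_closedBall 0 (2 * R)) φout
    have φle : ∀ z, 0 ≤ φ z ∧ φ z ≤ 1 := fun z => ⟨f.nonneg, f.le_one⟩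
    have dφ : ∀ z e, ‖e‖ ≤ 1 → |fderiv ℝ φ z e| ≤ C / R := by
      intro z e he
      have : fderiv ℝ φ z = R⁻¹ • fderiv ℝ f (R⁻¹ • z) := by
        simpa using fderiv_comp_smul (𝕜 := ℝ) (f := f) (x := z) R⁻¹
      rw [this, smul_apply, smul_eq_mul, abs_mul, abs_of_pos (inv_pos.2 hR),
        div_eq_inv_mul]
      gcongr
      calc |fderiv ℝ f (R⁻¹ • z) e| ≤ ‖fderiv ℝ f (R⁻¹ • z)‖ * ‖e‖ := by
            simpa using (fderiv ℝ f (R⁻¹ • z)).le_opNorm e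
        _ ≤ C * 1 := by gcongr; exact hC _
        _ = C := mul_one C
    have n1 : ‖((1 : ℝ), (0 : ℝ))‖ ≤ 1 := by simp
    have n2 : ‖((0 : ℝ), (1 : ℝ))‖ ≤ 1 := by simp
    have dφ0 : ∀ z ∈ Metric.ball (0 : ℝ × ℝ) R, fderiv ℝ φ z = 0 := by
      intro z hz
      have : φ =ᶠ[𝓝 z] fun _ => 1 := by
        filter_upwards [Metric.isOpen_ball.mem_nhds hz] with y hy
        exact φ1 y (Metric.ball_subset_closedBall hy)
      rw [this.fderiv_eq]; simp
    have dφout : ∀ z ∉ Metric.closedBall (0 : ℝ × ℝ) (2 * R), fderiv ℝ φ z = 0 := by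
      intro z hz
      have : φ =ᶠ[𝓝 z] fun _ => 0 := by
        filter_upwards [Metric.isClosed_closedBall.isOpen_compl.mem_nhds hz] with y hy
        exact φout y hy
      rw [this.fderiv_eq]; simp
    have main := integral_energy_cutoff_le hP hQ h cφ hc
    have iφE : Integrable (fun z => φ z ^ 2 * E z) := by
      refine Continuous.integrable_of_hasCompactSupport ((cφ.continuous.pow 2).mul cE) ?_
      have : HasCompactSupport (fun z => φ z ^ 2) := by
        have := hc.mul_right (f' := φ)
        simp_rw [pow_two]; exact this
      exact this.mul_right
    have Sle : S R ≤ ∫ z, φ z ^ 2 * E z := by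
      have : S R = ∫ z in Metric.closedBall 0 R, φ z ^ 2 * E z :=
        setIntegral_congr_fun measurableSet_closedBall fun z hz => by simp [φ1 z hz]
      rw [this]
      exact setIntegral_le_integral iφE (Eventually.of_forall fun z =>
        mul_nonneg (sq_nonneg _) (E0 z))
    have pt : ∀ z, ∀ l : ℝ, 0 < l →
        2 * φ z * (fderiv ℝ φ z (1, 0) * P z + fderiv ℝ φ z (0, 1) * Q z) ≤
          l * (φ z ^ 2 * E z) + 2 * (C / R) ^ 2 / l := by
      intro z l hl
      have hx := sq_le_sq' (abs_le.1 (dφ z (1, 0) n1)).1 (abs_le.1 (dφ z (1, 0) n1)).2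
      have hy := sq_le_sq' (abs_le.1 (dφ z (0, 1) n2)).1 (abs_le.1 (dφ z (0, 1) n2)).2
      generalize fderiv ℝ φ z (1, 0) = a at *
      generalize fderiv ℝ φ z (0, 1) = b at *
      rw [← sub_nonneg]
      have e : l * (φ z ^ 2 * E z) + 2 * (C / R) ^ 2 / l - 2 * φ z * (a * P z + b * Q z) =
        ((l * φ z * P z - a) ^ 2 + (l * φ z * Q z - b) ^ 2 +
          (((C / R) ^ 2 - a ^ 2) + ((C / R) ^ 2 - b ^ 2))) / l := by
        simp only [hE]
        field_simp
        ring
      rw [e]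
      apply div_nonneg _ hl.le
      have := sub_nonneg.2 hx
      have := sub_nonneg.2 hy
      positivity
    have irhs : Integrable (fun z =>
        2 * φ z * (fderiv ℝ φ z (1, 0) * P z + fderiv ℝ φ z (0, 1) * Q z)) := by
      refine Continuous.integrable_of_hasCompactSupport ?_ ?_
      · have := cφ.continuous_fderiv one_ne_zero
        have := cφ.continuous
        have := hP.continuous
        have := hQ.continuous
        fun_prop
      · exact (hc.mul_left (f := fun _ => (2 : ℝ))).mul_right
    have consts : ∀ l : ℝ, 0 < l →
        16 * R ^ 2 * (2 * (C / R) ^ 2 / l) = 32 * C ^ 2 / l := by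
      intro l hl; field_simp; ring
    have ic : ∀ c : ℝ, IntegrableOn (fun _ => c) (Metric.closedBall (0 : ℝ × ℝ) (2 * R)) :=
      fun c => continuousOn_const.integrableOn_compact (isCompact_closedBall 0 (2 * R))
    constructor
    · have h1 : ∫ z, 2 * φ z * (fderiv ℝ φ z (1, 0) * P z + fderiv ℝ φ z (0, 1) * Q z) ≤
          (1 / 2) * (∫ z, φ z ^ 2 * E z) + 32 * C ^ 2 / (1 / 2) := by
        rw [← setIntegral_eq_integral_of_forall_compl_eq_zero
          (s := Metric.closedBall (0 : ℝ × ℝ) (2 * R)) (fun z hz => by simp [φout z hz])]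
        calc _ ≤ ∫ z in Metric.closedBall (0 : ℝ × ℝ) (2 * R),
              ((1 / 2) * (φ z ^ 2 * E z) + 2 * (C / R) ^ 2 / (1 / 2)) :=
              setIntegral_mono irhs.integrableOn ((iφE.const_mul _).integrableOn.add (ic _))
                fun z => pt z _ one_half_pos
          _ ≤ _ := by
            rw [integral_add (iφE.const_mul _).integrableOn (ic _), integral_const_mul,
              setIntegral_const, vol R hR, smul_eq_mul, consts _ one_half_pos]
            have := setIntegral_le_integral (s := Metric.closedBall (0 : ℝ × ℝ) (2 * R)) iφE
              (Eventually.of_forall fun z => mul_nonneg (sq_nonneg _) (E0 z))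
            linarith
      have h2 := main.trans h1
      change ∫ z, φ z ^ 2 * E z ≤ _ at h2
      linarith [main]
    · intro l hl
      refine Sle.trans (main.trans ?_)
      set A := Metric.closedBall (0 : ℝ × ℝ) (2 * R) \ Metric.closedBall 0 R with hA
      have hsub : Metric.closedBall (0 : ℝ × ℝ) R ⊆ Metric.closedBall 0 (2 * R) :=
        Metric.closedBall_subset_closedBall (by linarith)
      have hsplit : S (2 * R) - S R = ∫ z in A, E z :=
        (setIntegral_sdiff measurableSet_closedBall (iE _) hsub).symm
      rw [hsplit]
      have hz : ∫ z, 2 * φ z * (fderiv ℝ φ z (1, 0) * P z + fderiv ℝ φ z (0, 1) * Q z) =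
          ∫ z in A, 2 * φ z * (fderiv ℝ φ z (1, 0) * P z + fderiv ℝ φ z (0, 1) * Q z) := by
        symm
        rw [setIntegral_eq_integral_of_ae_compl_eq_zero]
        have hsph : ∀ᵐ z : ℝ × ℝ, z ∉ Metric.sphere (0 : ℝ × ℝ) R :=
          measure_eq_zero_iff_ae_notMem.1 (Measure.addHaar_sphere _ _ _)
        filter_upwards [hsph] with z hz hzA
        by_cases h2 : z ∈ Metric.closedBall (0 : ℝ × ℝ) (2 * R)
        · have h3 : z ∈ Metric.closedBall (0 : ℝ × ℝ) R := by
            by_contra h4; exact hzA ⟨h2, h4⟩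
          have h5 : z ∈ Metric.ball (0 : ℝ × ℝ) R := by
            rw [Metric.mem_ball]
            exact lt_of_le_of_ne h3 hz
          simp [dφ0 z h5]
        · simp [φout z h2]
      rw [hz]
      have iA : IntegrableOn E A := (iE (2 * R)).mono_set sdiff_subset
      have icA : IntegrableOn (fun _ : ℝ × ℝ => 2 * (C / R) ^ 2 / l) A := (ic _).mono_set sdiff_subset
      calc _ ≤ ∫ z in A, (l * E z + 2 * (C / R) ^ 2 / l) := by
            refine setIntegral_mono irhs.integrableOn ((iA.const_mul _).add icA) fun z => ?_
            refine (pt z l hl).trans ?_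
            have : φ z ^ 2 ≤ 1 := pow_le_one₀ (φle z).1 (φle z).2
            have := mul_le_mul_of_nonneg_right this (E0 z)
            have := mul_le_mul_of_nonneg_left this hl.le
            linarith
        _ ≤ _ := by
            rw [integral_add (iA.const_mul _) icA, integral_const_mul, setIntegral_const,
              smul_eq_mul, ← consts l hl, ← vol R hR]
            gcongr
            · exact measure_closedBall_lt_top.ne
            · exact sdiff_subset
  have bdd : BddAbove (range fun n : ℕ => S ((2 : ℝ) ^ n)) :=
    ⟨128 * C ^ 2, by rintro _ ⟨n, rfl⟩; exact (key _ (by positivity)).1⟩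
  have mono2 : Monotone fun n : ℕ => S ((2 : ℝ) ^ n) := fun a b hab =>
    Smono (pow_le_pow_right₀ one_le_two hab)
  have lim := tendsto_atTop_ciSup mono2 bdd
  set L := ⨆ n : ℕ, S ((2 : ℝ) ^ n)
  have hL : ∀ l : ℝ, 0 < l → L ≤ l * (L - L) + 32 * C ^ 2 / l := by
    intro l hl
    have lim1 : Tendsto (fun n : ℕ => S (2 * (2 : ℝ) ^ n)) atTop (𝓝 L) := by
      have := lim.comp (tendsto_add_atTop_nat 1)
      refine this.congr fun n => ?_
      simp only [Function.comp, pow_succ']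
    refine le_of_tendsto_of_tendsto' lim (((lim1.sub lim).const_mul l).add_const _) fun n => ?_
    exact (key _ (by positivity)).2 l hl
  have L0 : L ≤ 0 := by
    have : Tendsto (fun l : ℝ => 32 * C ^ 2 / l) atTop (𝓝 0) :=
      tendsto_const_nhds.div_atTop tendsto_id
    refine ge_of_tendsto this ?_
    filter_upwards [eventually_gt_atTop 0] with l hl
    simpa using hL l hl
  have E00 : E z = 0 := by
    obtain ⟨n, hn⟩ := pow_unbounded_of_one_lt (‖z‖) (one_lt_two (α := ℝ))
    have hSn : S ((2 : ℝ) ^ n) = 0 := le_antisymm ((le_ciSup bdd n).trans L0) (S0 _)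
    have h1 := (setIntegral_eq_zero_iff_of_nonneg_ae (Eventually.of_forall E0) (iE _)).1 hSn
    have h2 : EqOn E (fun _ => 0) (Metric.ball 0 ((2 : ℝ) ^ n)) := by
      refine Measure.eqOn_open_of_ae_eq (μ := volume) ?_ Metric.isOpen_ball cE.continuousOn
        continuousOn_const
      exact ae_restrict_of_ae_restrict_of_subset Metric.ball_subset_closedBall h1
    exact h2 (by simpa using hn)
  have hp := sq_nonneg (P z)
  have hq := sq_nonneg (Q z)
  simp only [hE] at E00
  exact ⟨pow_eq_zero_iff two_ne_zero |>.1 (by linarith), pow_eq_zero_iff two_ne_zero |>.1 (by linarith)⟩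
end PlaneLiouville

section HorizontalFields
open Filter Topology

instance : (volume : Measure Heis).IsAddHaarMeasure :=
  inferInstanceAs ((volume : Measure ℝ).prod (volume : Measure (ℝ × ℝ))).IsAddHaarMeasure

/-- The derivative of `f` along the vector field `p ↦ a + ℓ(p) ∂_t`. -/
def fieldD (a : Heis) (ℓ : Heis →L[ℝ] ℝ) (f : Heis → ℝ) (p : Heis) : ℝ :=
  fderiv ℝ f p (a + ℓ p • ((0, 0, 1) : Heis))

/-- The coefficient `2y` of `∂_t` in `X`. -/
def ellX : Heis →L[ℝ] ℝ :=
  (2 : ℝ) • (ContinuousLinearMap.fst ℝ ℝ ℝ).comp (ContinuousLinearMap.snd ℝ ℝ (ℝ × ℝ))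

/-- The coefficient `-2x` of `∂_t` in `Y`. -/
def ellY : Heis →L[ℝ] ℝ := (-2 : ℝ) • ContinuousLinearMap.fst ℝ ℝ (ℝ × ℝ)

theorem ellX_apply (p : Heis) : ellX p = 2 * p.2.1 := rfl

theorem ellY_apply (p : Heis) : ellY p = -2 * p.1 := rfl

theorem Xd_eq_fieldD (f : Heis → ℝ) : Xd f = fieldD (1, 0, 0) ellX f := by
  funext p; simp [Xd, fieldD, ellX_apply]

theorem Yd_eq_fieldD (f : Heis → ℝ) : Yd f = fieldD (0, 1, 0) ellY f := by
  funext p; simp [Yd, fieldD, ellY_apply]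

theorem subLap_eq_fieldD (f : Heis → ℝ) (p : Heis) :
    subLap f p = fieldD (1, 0, 0) ellX (fieldD (1, 0, 0) ellX f) p +
      fieldD (0, 1, 0) ellY (fieldD (0, 1, 0) ellY f) p := by
  simp only [subLap, Xd_eq_fieldD, Yd_eq_fieldD]

theorem fieldD_eq (a : Heis) (ℓ : Heis →L[ℝ] ℝ) (f : Heis → ℝ) (p : Heis) :
    fieldD a ℓ f p = fderiv ℝ f p a + ℓ p * fderiv ℝ f p (0, 0, 1) := by
  simp only [fieldD, map_add, map_smul, smul_eq_mul]

theorem ContDiff.fieldD {f : Heis → ℝ} (hf : ContDiff ℝ (⊤ : ℕ∞) f) (a : Heis)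
    (ℓ : Heis →L[ℝ] ℝ) : ContDiff ℝ (⊤ : ℕ∞) (fieldD a ℓ f) := by
  have h : ContDiff ℝ (⊤ : ℕ∞) (fderiv ℝ f) := hf.fderiv_right (by simp)
  exact h.clm_apply (contDiff_const.add (ℓ.contDiff.smul contDiff_const))

theorem ContDiff.fderiv_apply_const {f : Heis → ℝ} (hf : ContDiff ℝ (⊤ : ℕ∞) f) (a : Heis) :
    ContDiff ℝ (⊤ : ℕ∞) (fun p => fderiv ℝ f p a) :=
  (hf.fderiv_right (m := (⊤ : ℕ∞)) (by simp)).clm_apply contDiff_const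

theorem ContDiff.subLap {f : Heis → ℝ} (hf : ContDiff ℝ (⊤ : ℕ∞) f) :
    ContDiff ℝ (⊤ : ℕ∞) (subLap f) := by
  rw [funext (subLap_eq_fieldD f)]
  exact ((hf.fieldD _ _).fieldD _ _).add ((hf.fieldD _ _).fieldD _ _)

theorem HasCompactSupport.fieldD {f : Heis → ℝ} (hf : HasCompactSupport f) (a : Heis)
    (ℓ : Heis →L[ℝ] ℝ) : HasCompactSupport (fieldD a ℓ f) := by
  refine HasCompactSupport.intro (K := tsupport f) hf fun x hx => ?_
  have : fderiv ℝ f x = 0 := by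
    by_contra h
    exact hx (support_fderiv_subset ℝ (f := f) h)
  simp [_root_.fieldD, this]

theorem HasCompactSupport.subLap {f : Heis → ℝ} (hf : HasCompactSupport f) :
    HasCompactSupport (subLap f) := by
  rw [funext (subLap_eq_fieldD f)]
  exact ((hf.fieldD _ _).fieldD _ _).add ((hf.fieldD _ _).fieldD _ _)

theorem integral_fderiv_mul_eq_neg {f Φ : Heis → ℝ} (hf : ContDiff ℝ 1 f) (hΦ : ContDiff ℝ 1 Φ)
    (hc : HasCompactSupport Φ) (e : Heis) :
    ∫ p, f p * fderiv ℝ Φ p e = -∫ p, fderiv ℝ f p e * Φ p := by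
  have cf : Continuous fun z => fderiv ℝ f z e :=
    (hf.continuous_fderiv one_ne_zero).clm_apply continuous_const
  have cφ : Continuous fun z => fderiv ℝ Φ z e :=
    (hΦ.continuous_fderiv one_ne_zero).clm_apply continuous_const
  refine integral_mul_fderiv_eq_neg_fderiv_mul_of_integrable ?_ ?_ ?_
    (fun z _ => hf.differentiable one_ne_zero z) (fun z _ => hΦ.differentiable one_ne_zero z)
  · exact (cf.mul hΦ.continuous).integrable_of_hasCompactSupport hc.mul_left
  · exact (hf.continuous.mul cφ).integrable_of_hasCompactSupport (hc.fderiv_apply ℝ e).mul_left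
  · exact (hf.continuous.mul hΦ.continuous).integrable_of_hasCompactSupport hc.mul_left

theorem fderiv_clm_mul (ℓ : Heis →L[ℝ] ℝ) {Φ : Heis → ℝ} (hΦ : Differentiable ℝ Φ) (e p : Heis) :
    fderiv ℝ (fun p => ℓ p * Φ p) p e = ℓ p * fderiv ℝ Φ p e + ℓ e * Φ p := by
  rw [fderiv_fun_mul ℓ.differentiableAt (hΦ p)]
  simp; ring

theorem integral_fieldD_mul_eq_neg {f Φ : Heis → ℝ} (hf : ContDiff ℝ 1 f) (hΦ : ContDiff ℝ 1 Φ)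
    (hc : HasCompactSupport Φ) (a : Heis) {ℓ : Heis →L[ℝ] ℝ} (hℓ : ℓ (0, 0, 1) = 0) :
    ∫ p, f p * fieldD a ℓ Φ p = -∫ p, fieldD a ℓ f p * Φ p := by
  have cf : ∀ e, Continuous fun z => fderiv ℝ f z e := fun e =>
    (hf.continuous_fderiv one_ne_zero).clm_apply continuous_const
  have cφ : ∀ e, Continuous fun z => fderiv ℝ Φ z e := fun e =>
    (hΦ.continuous_fderiv one_ne_zero).clm_apply continuous_const
  have hcf := fun e => hc.fderiv_apply ℝ e
  have h1 := integral_fderiv_mul_eq_neg hf hΦ hc a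
  have h2 := integral_fderiv_mul_eq_neg hf (Φ := fun p => ℓ p * Φ p) (ℓ.contDiff.mul hΦ)
    hc.mul_left (0, 0, 1)
  simp only [fderiv_clm_mul ℓ (hΦ.differentiable one_ne_zero), hℓ, zero_mul, add_zero] at h2
  have e1 : ∀ p, f p * fieldD a ℓ Φ p =
      f p * fderiv ℝ Φ p a + f p * (ℓ p * fderiv ℝ Φ p (0, 0, 1)) := fun p => by
    rw [fieldD_eq, mul_add]
  have e2 : ∀ p, fieldD a ℓ f p * Φ p =
      fderiv ℝ f p a * Φ p + fderiv ℝ f p (0, 0, 1) * (ℓ p * Φ p) := fun p => by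
    rw [fieldD_eq]; ring
  simp_rw [e1, e2]
  rw [integral_add, integral_add, h1, h2]
  · ring
  · exact ((cf _).mul hΦ.continuous).integrable_of_hasCompactSupport hc.mul_left
  · exact ((cf _).mul (ℓ.continuous.mul hΦ.continuous)).integrable_of_hasCompactSupport
      hc.mul_left.mul_left
  · exact (hf.continuous.mul (cφ _)).integrable_of_hasCompactSupport (hcf a).mul_left
  · exact (hf.continuous.mul (ℓ.continuous.mul (cφ _))).integrable_of_hasCompactSupport
      (hcf _).mul_left.mul_left

/-- Integration against `Φ` of a function with constant `∂_t`-derivative. -/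
theorem integral_mul_fieldD_of_fderiv_const {w Φ : Heis → ℝ} {c : ℝ} (hw : Differentiable ℝ w)
    (hwc : ∀ p, fderiv ℝ w p (0, 0, 1) = c) (hΦ : ContDiff ℝ 1 Φ) (hc : HasCompactSupport Φ)
    (a : Heis) {ℓ : Heis →L[ℝ] ℝ} (hℓ : ℓ (0, 0, 1) = 0) :
    ∫ p, w p * fieldD a ℓ Φ p = (∫ p, w p * fderiv ℝ Φ p a) - c * ∫ p, ℓ p * Φ p := by
  have cφ : ∀ e, Continuous fun z => fderiv ℝ Φ z e := fun e =>
    (hΦ.continuous_fderiv one_ne_zero).clm_apply continuous_const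
  have hcf := fun e => hc.fderiv_apply ℝ e
  have i0 : Integrable (fun p => ℓ p * Φ p) :=
    (ℓ.continuous.mul hΦ.continuous).integrable_of_hasCompactSupport hc.mul_left
  have i1 : Integrable fun p => w p * (ℓ p * fderiv ℝ Φ p (0, 0, 1)) :=
    (hw.continuous.mul (ℓ.continuous.mul (cφ _))).integrable_of_hasCompactSupport
      (hcf _).mul_left.mul_left
  have e0 : ∀ p, fderiv ℝ (fun p => ℓ p * Φ p) p (0, 0, 1) = ℓ p * fderiv ℝ Φ p (0, 0, 1) := by
    intro p
    rw [fderiv_clm_mul ℓ (hΦ.differentiable one_ne_zero), hℓ, zero_mul, add_zero]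
  have h2 : ∫ p, w p * fderiv ℝ (fun p => ℓ p * Φ p) p (0, 0, 1) =
      -∫ p, fderiv ℝ w p (0, 0, 1) * (ℓ p * Φ p) := by
    refine integral_mul_fderiv_eq_neg_fderiv_mul_of_integrable ?_ ?_ ?_
      (fun z _ => hw z)
      (fun z _ => (ℓ.differentiable.mul (hΦ.differentiable one_ne_zero)) z)
    · simp_rw [hwc]; exact i0.const_mul c
    · simp_rw [e0]; exact i1
    · exact (hw.continuous.mul (ℓ.continuous.mul hΦ.continuous)).integrable_of_hasCompactSupport
        hc.mul_left.mul_left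
  simp_rw [e0, hwc] at h2
  rw [integral_const_mul] at h2
  simp_rw [fieldD_eq, mul_add]
  rw [integral_add _ i1, h2]
  · ring
  · exact (hw.continuous.mul (cφ _)).integrable_of_hasCompactSupport (hcf a).mul_left

theorem integral_mul_fieldD_fieldD_of_fderiv_const {w Φ : Heis → ℝ} {c : ℝ}
    (hw : Differentiable ℝ w) (hwc : ∀ p, fderiv ℝ w p (0, 0, 1) = c)
    (hΦ : ContDiff ℝ (⊤ : ℕ∞) Φ) (hc : HasCompactSupport Φ) {a : Heis} {ℓ : Heis →L[ℝ] ℝ}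
    (hℓ : ℓ (0, 0, 1) = 0) (ha : ℓ a = 0) :
    ∫ p, w p * fieldD a ℓ (fieldD a ℓ Φ) p =
      ∫ p, w p * fderiv ℝ (fun q => fderiv ℝ Φ q a) p a := by
  have top1 : (1 : WithTop ℕ∞) ≤ ((⊤ : ℕ∞) : WithTop ℕ∞) := by exact_mod_cast le_top
  have hZ := hΦ.fieldD a ℓ
  have hD := hΦ.fderiv_apply_const a
  have hdΦ : Differentiable ℝ (fderiv ℝ Φ) :=
    (hΦ.fderiv_right (m := (⊤ : ℕ∞)) (by simp)).differentiable (by simp)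
  rw [integral_mul_fieldD_of_fderiv_const hw hwc (hZ.of_le top1) (hc.fieldD a ℓ) a hℓ]
  have z1 : ∫ p, ℓ p * fieldD a ℓ Φ p = 0 := by
    rw [integral_fieldD_mul_eq_neg ℓ.contDiff (hΦ.of_le top1) hc a hℓ]
    have : ∀ p, fieldD a ℓ ℓ p = 0 := fun p => by
      rw [fieldD_eq, ContinuousLinearMap.fderiv, hℓ, ha]; simp
    simp [this]
  have z2 : ∫ p, ℓ p * fderiv ℝ Φ p a = 0 := by
    rw [integral_fderiv_mul_eq_neg ℓ.contDiff (hΦ.of_le top1) hc a]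
    simp [ha]
  have comm : ∀ p, fderiv ℝ (fieldD a ℓ Φ) p a = fieldD a ℓ (fun q => fderiv ℝ Φ q a) p := by
    intro p
    have hfe : fieldD a ℓ Φ = fun q => fderiv ℝ Φ q a + ℓ q * fderiv ℝ Φ q (0, 0, 1) :=
      funext (fieldD_eq a ℓ Φ)
    have ap : ∀ e e' : Heis, fderiv ℝ (fun q => fderiv ℝ Φ q e) p e' =
        fderiv ℝ (fderiv ℝ Φ) p e' e := by
      intro e e'
      rw [fderiv_clm_apply (hdΦ p) (differentiableAt_const e)]
      simp
    have hd3 : Differentiable ℝ fun q => fderiv ℝ Φ q (0, 0, 1) :=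
      (hΦ.fderiv_apply_const _).differentiable (by simp)
    have sym : fderiv ℝ (fderiv ℝ Φ) p a (0, 0, 1) = fderiv ℝ (fderiv ℝ Φ) p (0, 0, 1) a :=
      (hΦ.contDiffAt.isSymmSndFDerivAt (by
        rw [minSmoothness_of_isRCLikeNormedField]; exact WithTop.coe_le_coe.2 le_top)).eq a (0, 0, 1)
    have hd4 : DifferentiableAt ℝ (fun q => ℓ q * fderiv ℝ Φ q (0, 0, 1)) p :=
      (ℓ.differentiable.mul hd3) p
    rw [hfe, fderiv_fun_add (hD.differentiable (by simp) p) hd4, fieldD_eq, add_apply,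
      fderiv_clm_mul ℓ hd3, ha, zero_mul, add_zero, ap, ap, ap, sym]
  simp_rw [comm, z1]
  rw [integral_mul_fieldD_of_fderiv_const hw hwc (hD.of_le top1) (hc.fderiv_apply ℝ a) a hℓ, z2]
  ring

theorem fieldD_shift (a : Heis) {ℓ : Heis →L[ℝ] ℝ} (hℓ : ℓ (0, 0, 1) = 0) (f : Heis → ℝ) (s : ℝ) :
    fieldD a ℓ (fun x => f (x + s • ((0, 0, 1) : Heis))) =
      fun x => fieldD a ℓ f (x + s • ((0, 0, 1) : Heis)) := by
  funext p
  simp only [fieldD]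
  rw [fderiv_comp_add_right, map_add ℓ, map_smul, hℓ, smul_zero, add_zero]

theorem ellX_vert : ellX (0, 0, 1) = 0 := by simp [ellX_apply]

theorem ellY_vert : ellY (0, 0, 1) = 0 := by simp [ellY_apply]

/-- The transpose of `f ↦ -Δ_b f - 2 b · ∇_b f`. -/
def testOp (b₁ b₂ : ℝ) (Φ : Heis → ℝ) (p : Heis) : ℝ :=
  -subLap Φ p + 2 * b₁ * Xd Φ p + 2 * b₂ * Yd Φ p

theorem integral_mul_testOp {f Φ : Heis → ℝ} (hf : ContDiff ℝ (⊤ : ℕ∞) f)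
    (hΦ : ContDiff ℝ (⊤ : ℕ∞) Φ) (hc : HasCompactSupport Φ) (b₁ b₂ : ℝ) :
    ∫ p, f p * testOp b₁ b₂ Φ p =
      ∫ p, (-subLap f p - 2 * b₁ * Xd f p - 2 * b₂ * Yd f p) * Φ p := by
  have top1 : (1 : WithTop ℕ∞) ≤ ((⊤ : ℕ∞) : WithTop ℕ∞) := by exact_mod_cast le_top
  have first : ∀ (g Ψ : Heis → ℝ) (a : Heis) (ℓ : Heis →L[ℝ] ℝ), ContDiff ℝ (⊤ : ℕ∞) g →
      ContDiff ℝ (⊤ : ℕ∞) Ψ → HasCompactSupport Ψ → ℓ (0, 0, 1) = 0 →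
      Integrable (fun p => g p * fieldD a ℓ Ψ p) ∧ Integrable (fun p => fieldD a ℓ g p * Ψ p) ∧
      ∫ p, g p * fieldD a ℓ Ψ p = -∫ p, fieldD a ℓ g p * Ψ p := by
    intro g Ψ a ℓ hg hΨ hcΨ hℓ
    refine ⟨?_, ?_, integral_fieldD_mul_eq_neg (hg.of_le top1) (hΨ.of_le top1) hcΨ a hℓ⟩
    · exact (hg.continuous.mul (hΨ.fieldD a ℓ).continuous).integrable_of_hasCompactSupport
        (hcΨ.fieldD a ℓ).mul_left
    · exact ((hg.fieldD a ℓ).continuous.mul hΨ.continuous).integrable_of_hasCompactSupport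
        hcΨ.mul_left
  have second : ∀ (a : Heis) (ℓ : Heis →L[ℝ] ℝ), ℓ (0, 0, 1) = 0 →
      Integrable (fun p => f p * fieldD a ℓ (fieldD a ℓ Φ) p) ∧
      Integrable (fun p => fieldD a ℓ (fieldD a ℓ f) p * Φ p) ∧
      ∫ p, f p * fieldD a ℓ (fieldD a ℓ Φ) p = ∫ p, fieldD a ℓ (fieldD a ℓ f) p * Φ p := by
    intro a ℓ hℓ
    obtain ⟨i1, -, h1⟩ := first f (fieldD a ℓ Φ) a ℓ hf (hΦ.fieldD a ℓ) (hc.fieldD a ℓ) hℓ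
    obtain ⟨-, i2, h2⟩ := first (fieldD a ℓ f) Φ a ℓ (hf.fieldD a ℓ) hΦ hc hℓ
    exact ⟨i1, i2, by rw [h1, h2, neg_neg]⟩
  obtain ⟨x1, x2, x3⟩ := first f Φ (1, 0, 0) ellX hf hΦ hc ellX_vert
  obtain ⟨y1, y2, y3⟩ := first f Φ (0, 1, 0) ellY hf hΦ hc ellY_vert
  obtain ⟨xx1, xx2, xx3⟩ := second (1, 0, 0) ellX ellX_vert
  obtain ⟨yy1, yy2, yy3⟩ := second (0, 1, 0) ellY ellY_vert
  have e1 : ∀ p, f p * testOp b₁ b₂ Φ p =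
      (2 * b₁) * (f p * fieldD (1, 0, 0) ellX Φ p) + (2 * b₂) * (f p * fieldD (0, 1, 0) ellY Φ p) -
      (f p * fieldD (1, 0, 0) ellX (fieldD (1, 0, 0) ellX Φ) p +
        f p * fieldD (0, 1, 0) ellY (fieldD (0, 1, 0) ellY Φ) p) := fun p => by
    rw [testOp, subLap_eq_fieldD, Xd_eq_fieldD, Yd_eq_fieldD]; ring
  have e2 : ∀ p, (-subLap f p - 2 * b₁ * Xd f p - 2 * b₂ * Yd f p) * Φ p =
      (-(2 * b₁)) * (fieldD (1, 0, 0) ellX f p * Φ p) +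
        (-(2 * b₂)) * (fieldD (0, 1, 0) ellY f p * Φ p) -
      (fieldD (1, 0, 0) ellX (fieldD (1, 0, 0) ellX f) p * Φ p +
        fieldD (0, 1, 0) ellY (fieldD (0, 1, 0) ellY f) p * Φ p) := fun p => by
    rw [subLap_eq_fieldD, Xd_eq_fieldD, Yd_eq_fieldD]; ring
  have comb : ∀ (α β : ℝ) (A B C D : Heis → ℝ), Integrable A → Integrable B → Integrable C →
      Integrable D → ∫ p, (α * A p + β * B p - (C p + D p)) =
        α * (∫ p, A p) + β * (∫ p, B p) - ((∫ p, C p) + ∫ p, D p) := by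
    intro α β A B C D hA hB hC hD
    have hA' := hA.const_mul α
    have hB' := hB.const_mul β
    rw [integral_sub (f := fun p => α * A p + β * B p) (g := fun p => C p + D p)
      (hA'.add hB') (hC.add hD), integral_add hA' hB', integral_add hC hD,
      integral_const_mul, integral_const_mul]
  simp_rw [e1, e2]
  rw [comb _ _ _ _ _ _ x1 y1 xx1 yy1, comb _ _ _ _ _ _ x2 y2 xx2 yy2, x3, y3, xx3, yy3]
  ring

theorem contDiff_testOp {Φ : Heis → ℝ} (hΦ : ContDiff ℝ (⊤ : ℕ∞) Φ) (b₁ b₂ : ℝ) :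
    ContDiff ℝ (⊤ : ℕ∞) (testOp b₁ b₂ Φ) := by
  have hX := hΦ.fieldD (1, 0, 0) ellX
  have hY := hΦ.fieldD (0, 1, 0) ellY
  rw [← Xd_eq_fieldD] at hX
  rw [← Yd_eq_fieldD] at hY
  exact (hΦ.subLap.neg.add (contDiff_const.mul hX)).add (contDiff_const.mul hY)

theorem hasCompactSupport_testOp {Φ : Heis → ℝ} (hc : HasCompactSupport Φ) (b₁ b₂ : ℝ) :
    HasCompactSupport (testOp b₁ b₂ Φ) := by
  have hX := hc.fieldD (1, 0, 0) ellX
  have hY := hc.fieldD (0, 1, 0) ellY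
  rw [← Xd_eq_fieldD] at hX
  rw [← Yd_eq_fieldD] at hY
  exact (hc.subLap.neg.add (hX.mul_left (f := fun _ => 2 * b₁))).add
    (hY.mul_left (f := fun _ => 2 * b₂))

theorem integral_testOp {Φ : Heis → ℝ} (hΦ : ContDiff ℝ (⊤ : ℕ∞) Φ)
    (hc : HasCompactSupport Φ) (b₁ b₂ : ℝ) : ∫ p, testOp b₁ b₂ Φ p = 0 := by
  have h := integral_mul_testOp (f := fun _ => 1) contDiff_const hΦ hc b₁ b₂
  have hX : ∀ c : ℝ, Xd (fun _ => c) = fun _ => 0 := fun c => by funext p; simp [Xd]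
  have hY : ∀ c : ℝ, Yd (fun _ => c) = fun _ => 0 := fun c => by funext p; simp [Yd]
  simpa [subLap, hX, hY] using h

theorem eventually_integral_shift_mul_testOp_nonneg {u Φ : Heis → ℝ}
    (hu : ContDiff ℝ (⊤ : ℕ∞) u) {K : Set Heis} (hK : IsCompact K)
    (hW : ∀ p ∉ K, gradb2 u p ≤ -(subLap u p)) (hΦ : ContDiff ℝ (⊤ : ℕ∞) Φ)
    (hc : HasCompactSupport Φ) (hΦ0 : ∀ p, 0 ≤ Φ p) (b₁ b₂ : ℝ) :
    ∀ᶠ n : ℕ in atTop, 0 ≤ (∫ p, u (p + (n : ℝ) • ((0, 0, 1) : Heis)) * testOp b₁ b₂ Φ p) +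
      (b₁ ^ 2 + b₂ ^ 2) * ∫ p, Φ p := by
  obtain ⟨M, hM⟩ := hK.isBounded.exists_norm_le
  obtain ⟨M', hM'⟩ := hc.isCompact.isBounded.exists_norm_le
  filter_upwards [(tendsto_natCast_atTop_atTop (R := ℝ)).eventually_gt_atTop (M + M')] with n hn
  have hun : ContDiff ℝ (⊤ : ℕ∞) fun p : Heis => u (p + (n : ℝ) • ((0, 0, 1) : Heis)) :=
    hu.comp (contDiff_id.add contDiff_const)
  rw [integral_mul_testOp hun hΦ hc, ← integral_const_mul, ← integral_add]
  · refine integral_nonneg fun p => ?_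
    simp only [Pi.zero_apply]
    rw [← add_mul]
    by_cases hp : p ∈ tsupport Φ
    · refine mul_nonneg ?_ (hΦ0 p)
      have hpK : p + (n : ℝ) • ((0, 0, 1) : Heis) ∉ K := by
        intro h
        have h1 := hM _ h
        have h2 := hM' _ hp
        have h3 : ‖(n : ℝ) • ((0, 0, 1) : Heis)‖ = n := by
          rw [norm_smul]; simp [Prod.norm_def]
        have h4 := norm_sub_le (p + (n : ℝ) • ((0, 0, 1) : Heis)) p
        rw [add_sub_cancel_left, h3] at h4
        linarith
      have := hW _ hpK
      rw [subLap_eq_fieldD, Xd_eq_fieldD, Yd_eq_fieldD, fieldD_shift _ ellX_vert,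
        fieldD_shift _ ellY_vert, fieldD_shift _ ellX_vert, fieldD_shift _ ellY_vert]
      rw [gradb2, subLap_eq_fieldD, Xd_eq_fieldD, Yd_eq_fieldD] at this
      nlinarith [sq_nonneg (fieldD (1, 0, 0) ellX u (p + (n : ℝ) • ((0, 0, 1) : Heis)) - b₁),
        sq_nonneg (fieldD (0, 1, 0) ellY u (p + (n : ℝ) • ((0, 0, 1) : Heis)) - b₂)]
    · rw [image_eq_zero_of_notMem_tsupport hp, mul_zero]
  · refine Continuous.integrable_of_hasCompactSupport ?_ hc.mul_left
    have c1 := hun.subLap.continuous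
    have c2 := (hun.fieldD (1, 0, 0) ellX).continuous
    have c3 := (hun.fieldD (0, 1, 0) ellY).continuous
    rw [← Xd_eq_fieldD] at c2
    rw [← Yd_eq_fieldD] at c3
    exact ((c1.neg.sub (continuous_const.mul c2)).sub (continuous_const.mul c3)).mul hΦ.continuous
  · exact (continuous_const.mul hΦ.continuous).integrable_of_hasCompactSupport hc.mul_left

end HorizontalFields

section KoranyiLog
open Filter Topology Set
open scoped ENNReal

/-- The fourth power of the Korányi norm. -/
def korN (p : Heis) : ℝ := (p.1 ^ 2 + p.2.1 ^ 2) ^ 2 + p.2.2 ^ 2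

theorem korN_nonneg (p : Heis) : 0 ≤ korN p := by unfold korN; positivity

theorem continuous_korN : Continuous korN := by unfold korN; fun_prop

theorem korN_Hinv (p : Heis) : korN (Hinv p) = korN p := by simp [korN, Hinv]

theorem korN_eq_zero {p : Heis} (h : korN p = 0) : p = 0 := by
  unfold korN at h
  have h1 : p.2.2 = 0 := by
    apply pow_eq_zero_iff two_ne_zero |>.1; nlinarith [sq_nonneg (p.1 ^ 2 + p.2.1 ^ 2), sq_nonneg p.2.2]
  have h2 : p.1 ^ 2 + p.2.1 ^ 2 = 0 := by
    apply pow_eq_zero_iff two_ne_zero |>.1; nlinarith [sq_nonneg (p.1 ^ 2 + p.2.1 ^ 2), sq_nonneg p.2.2]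
  have h3 : p.1 = 0 := by
    apply pow_eq_zero_iff two_ne_zero |>.1; nlinarith [sq_nonneg p.1, sq_nonneg p.2.1]
  have h4 : p.2.1 = 0 := by
    apply pow_eq_zero_iff two_ne_zero |>.1; nlinarith [sq_nonneg p.1, sq_nonneg p.2.1]
  ext <;> simp [h1, h3, h4]

theorem log_rho_div {p q : Heis} (hp : p ≠ 0) (hq : q ≠ 0) :
    log (rho p / rho q) = (log (korN p) - log (korN q)) / 4 := by
  have hp' : 0 < korN p := lt_of_le_of_ne (korN_nonneg p) fun h => hp (korN_eq_zero h.symm)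
  have hq' : 0 < korN q := lt_of_le_of_ne (korN_nonneg q) fun h => hq (korN_eq_zero h.symm)
  change log (korN p ^ ((1 : ℝ) / 4) / korN q ^ ((1 : ℝ) / 4)) = _
  rw [log_div (by positivity) (by positivity), log_rpow hp', log_rpow hq']
  ring

theorem one_le_korN {p : Heis} (h : 1 ≤ ‖p‖) : 1 ≤ korN p := by
  unfold korN
  simp only [Prod.norm_def, le_sup_iff, Real.norm_eq_abs, ← one_le_sq_iff_one_le_abs] at h
  rcases h with h | h | h
  · nlinarith [sq_nonneg p.2.1, sq_nonneg p.2.2]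
  · nlinarith [sq_nonneg p.1, sq_nonneg p.2.2]
  · nlinarith [sq_nonneg (p.1 ^ 2 + p.2.1 ^ 2)]

theorem one_add_korN_Hmul_le (p q : Heis) :
    1 + korN (Hmul p q) ≤ 14 * ((1 + korN p) * (1 + korN q)) := by
  have hp := korN_nonneg p
  have hq := korN_nonneg q
  suffices korN (Hmul p q) ≤ 14 * (korN p + korN q) by nlinarith [mul_nonneg hp hq]
  obtain ⟨a, b, t⟩ := p
  obtain ⟨c, d, s⟩ := q
  simp only [korN, Hmul]
  have h1 : ((a + c) ^ 2 + (b + d) ^ 2) ^ 2 ≤ 8 * ((a ^ 2 + b ^ 2) ^ 2 + (c ^ 2 + d ^ 2) ^ 2) := by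
    have : (a + c) ^ 2 + (b + d) ^ 2 ≤ 2 * (a ^ 2 + b ^ 2 + (c ^ 2 + d ^ 2)) := by
      nlinarith [sq_nonneg (a - c), sq_nonneg (b - d)]
    calc _ ≤ (2 * (a ^ 2 + b ^ 2 + (c ^ 2 + d ^ 2))) ^ 2 := by gcongr
      _ ≤ _ := by nlinarith [sq_nonneg (a ^ 2 + b ^ 2 - (c ^ 2 + d ^ 2))]
  have h2 : (2 * (b * c - a * d)) ^ 2 ≤ 2 * ((a ^ 2 + b ^ 2) ^ 2 + (c ^ 2 + d ^ 2) ^ 2) := by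
    nlinarith [sq_nonneg (b * d + a * c), sq_nonneg (a ^ 2 + b ^ 2 - (c ^ 2 + d ^ 2))]
  have h3 : (t + s + 2 * (b * c - a * d)) ^ 2 ≤
      3 * (t ^ 2 + s ^ 2 + (2 * (b * c - a * d)) ^ 2) := by
    nlinarith [sq_nonneg (t - s), sq_nonneg (t - 2 * (b * c - a * d)),
      sq_nonneg (s - 2 * (b * c - a * d))]
  nlinarith [sq_nonneg t, sq_nonneg s]

theorem log_one_add_korN_Hmul_le (p q : Heis) :
    log (1 + korN (Hmul p q)) ≤ log 14 + log (1 + korN p) + log (1 + korN q) := by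
  have hp := korN_nonneg p
  have hq := korN_nonneg q
  have h := korN_nonneg (Hmul p q)
  rw [add_assoc, ← log_mul (by positivity) (by positivity), ← log_mul (by positivity) (by positivity)]
  exact log_le_log (by positivity) (one_add_korN_Hmul_le p q)

theorem abs_log_one_add_korN_Hmul_sub_le (p q : Heis) :
    |log (1 + korN (Hmul p q)) - log (1 + korN p)| ≤ log 14 + log (1 + korN q) := by
  have h1 := log_one_add_korN_Hmul_le p q
  have h2 := log_one_add_korN_Hmul_le (Hmul p q) (Hinv q)
  have e : Hmul (Hmul p q) (Hinv q) = p := by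
    ext <;> simp [Hmul, Hinv]; ring
  rw [e, korN_Hinv] at h2
  rw [abs_le]; constructor <;> linarith

/-- An integrable majorant for the logarithmic singularity, infinite at the singular point. -/
def singE (s : ℝ) : ℝ≥0∞ :=
  if s = 0 then ⊤ else ENNReal.ofReal ((Icc (-1) 1).indicator (fun s => -2 * log s) s)

theorem measurable_singE : Measurable singE := by
  unfold singE
  refine Measurable.ite (measurableSet_singleton 0) measurable_const ?_
  exact ENNReal.measurable_ofReal.comp
    ((measurable_log.const_mul (-2)).indicator measurableSet_Icc)

theorem lintegral_singE_ne_top : ∫⁻ s, singE s ≠ ⊤ := by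
  have hI : Integrable ((Icc (-1 : ℝ) 1).indicator (fun s => -2 * log s)) := by
    rw [integrable_indicator_iff measurableSet_Icc]
    have : IntervalIntegrable log volume (-1) 1 := intervalIntegral.intervalIntegrable_log'
    rw [intervalIntegrable_iff_integrableOn_Icc_of_le (by norm_num)] at this
    exact this.const_mul (-2)
  have : ∫⁻ s, singE s =
      ∫⁻ s, ENNReal.ofReal ((Icc (-1 : ℝ) 1).indicator (fun s => -2 * log s) s) := by
    refine lintegral_congr_ae ?_
    have : ∀ᵐ s : ℝ, s ≠ 0 := by simp [ae_iff]
    filter_upwards [this] with s hs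
    simp [singE, hs]
  rw [this]
  exact hI.lintegral_lt_top.ne

theorem log_one_add_sub_log_le {x : ℝ} (hx : 1 ≤ x) : |log x - log (1 + x)| ≤ log 2 := by
  have h1 : log x ≤ log (1 + x) := log_le_log (by linarith) (by linarith)
  have h2 : log (1 + x) ≤ log 2 + log x := by
    rw [← log_mul two_ne_zero (by linarith)]
    exact log_le_log (by linarith) (by linarith)
  rw [abs_le]; constructor <;> linarith [log_nonneg one_le_two]

theorem enorm_log_korN_sub_le (p : Heis) :
    ‖log (korN p) - log (1 + korN p)‖ₑ ≤ singE p.2.2 + ENNReal.ofReal (log 2) := by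
  by_cases h0 : p.2.2 = 0
  · simp [singE, h0]
  by_cases h1 : 1 ≤ korN p
  · refine le_add_left ?_
    rw [← ofReal_norm]
    exact ENNReal.ofReal_le_ofReal (log_one_add_sub_log_le h1)
  push Not at h1
  have hsq : 0 < p.2.2 ^ 2 := by positivity
  have hle : p.2.2 ^ 2 ≤ korN p := by
    unfold korN; nlinarith [sq_nonneg (p.1 ^ 2 + p.2.1 ^ 2)]
  have hmem : p.2.2 ∈ Icc (-1 : ℝ) 1 := by
    rw [mem_Icc, ← abs_le]
    exact (sq_le_one_iff_abs_le_one _).1 (by linarith)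
  have hN : 0 < korN p := lt_of_lt_of_le hsq hle
  have h3 : 2 * log p.2.2 ≤ log (korN p) := by
    have := log_le_log hsq hle
    rwa [log_pow, Nat.cast_ofNat] at this
  have h4 : log (1 + korN p) ≤ log 2 := log_le_log (by linarith) (by linarith)
  have h5 : log (korN p) ≤ log (1 + korN p) := log_le_log hN (by linarith)
  have h6 : log (korN p) ≤ 0 := log_nonpos hN.le h1.le
  rw [singE, if_neg h0, indicator_of_mem hmem,
    ← ENNReal.ofReal_add (by linarith) (log_nonneg one_le_two), ← ofReal_norm]
  refine ENNReal.ofReal_le_ofReal ?_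
  rw [Real.norm_eq_abs, abs_le]
  constructor <;> linarith [log_nonneg one_le_two]

theorem lintegral_singE_shear_le (M : ℝ) {h : ℝ → ℝ → ℝ} (hh : Measurable (Function.uncurry h)) :
    ∫⁻ x : Heis, (Icc (-M) M).indicator 1 x.1 *
      ((Icc (-M) M).indicator 1 x.2.1 * singE (x.2.2 + h x.1 x.2.1)) ≤
      ENNReal.ofReal (2 * M) * (ENNReal.ofReal (2 * M) * ∫⁻ s, singE s) := by
  have mI : Measurable ((Icc (-M) M).indicator (1 : ℝ → ℝ≥0∞)) :=
    measurable_one.indicator measurableSet_Icc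
  have hh3 : Measurable fun x : ℝ × ℝ × ℝ => h x.1 x.2.1 :=
    hh.comp (measurable_fst.prodMk (measurable_fst.comp measurable_snd))
  have hh2 : ∀ a, Measurable fun x : ℝ × ℝ => h a x.1 := fun a =>
    hh.comp (measurable_const.prodMk measurable_fst)
  have vI : ∫⁻ a, (Icc (-M) M).indicator (1 : ℝ → ℝ≥0∞) a = ENNReal.ofReal (2 * M) := by
    rw [lintegral_indicator_one measurableSet_Icc, Real.volume_Icc]
    congr 1; ring
  have m3 : Measurable fun x : ℝ × ℝ × ℝ => (Icc (-M) M).indicator (1 : ℝ → ℝ≥0∞) x.1 *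
      ((Icc (-M) M).indicator 1 x.2.1 * singE (x.2.2 + h x.1 x.2.1)) :=
    (mI.comp measurable_fst).mul ((mI.comp (measurable_fst.comp measurable_snd)).mul
      (measurable_singE.comp ((measurable_snd.comp measurable_snd).add hh3)))
  have m2 : ∀ a, Measurable fun x : ℝ × ℝ =>
      (Icc (-M) M).indicator (1 : ℝ → ℝ≥0∞) x.1 * singE (x.2 + h a x.1) := fun a =>
    (mI.comp measurable_fst).mul (measurable_singE.comp (measurable_snd.add (hh2 a)))
  rw [Measure.volume_eq_prod, lintegral_prod _ m3.aemeasurable]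
  have inner : ∀ a, ∫⁻ y : ℝ × ℝ, (Icc (-M) M).indicator (1 : ℝ → ℝ≥0∞) a *
      ((Icc (-M) M).indicator 1 y.1 * singE (y.2 + h a y.1)) =
      (Icc (-M) M).indicator (1 : ℝ → ℝ≥0∞) a * (ENNReal.ofReal (2 * M) * ∫⁻ s, singE s) := by
    intro a
    rw [lintegral_const_mul _ (m2 a), Measure.volume_eq_prod, lintegral_prod _ (m2 a).aemeasurable]
    congr 1
    have : ∀ b, ∫⁻ t, (Icc (-M) M).indicator (1 : ℝ → ℝ≥0∞) b * singE (t + h a b) =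
        (Icc (-M) M).indicator (1 : ℝ → ℝ≥0∞) b * ∫⁻ s, singE s := by
      intro b
      have m1 : Measurable fun t => singE (t + h a b) :=
        measurable_singE.comp (measurable_id.add_const _)
      rw [lintegral_const_mul _ m1, lintegral_add_right_eq_self singE]
    simp_rw [this]
    rw [lintegral_mul_const _ mI, vI]
  simp_rw [inner]
  rw [lintegral_mul_const _ mI, vI]

/-- Uniform integrability of the translated logarithm against a compactly supported function. -/
theorem exists_lintegral_log_korN_Hmul_le {Ψ : Heis → ℝ} (hΨ : Continuous Ψ)
    (hc : HasCompactSupport Ψ) : ∃ C : ℝ≥0∞, C ≠ ⊤ ∧ ∀ q : Heis,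
      ∫⁻ x, ‖(log (korN (Hmul q x)) - log (1 + korN q)) * Ψ x‖ₑ ≤ C := by
  obtain ⟨M, hM⟩ := hc.isCompact.isBounded.exists_norm_le
  obtain ⟨B, hB⟩ := hc.exists_bound_of_continuous hΨ
  have hL : Continuous fun x : Heis => (log (1 + korN x) + (log 14 + log 2)) * |Ψ x| := by
    refine Continuous.mul (Continuous.add (Continuous.log ?_ ?_) continuous_const) hΨ.abs
    · exact continuous_const.add continuous_korN
    · intro x; have := korN_nonneg x; positivity
  have iL : Integrable fun x : Heis => (log (1 + korN x) + (log 14 + log 2)) * |Ψ x| :=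
    hL.integrable_of_hasCompactSupport hc.abs.mul_left
  refine ⟨ENNReal.ofReal B * (ENNReal.ofReal (2 * M) * (ENNReal.ofReal (2 * M) * ∫⁻ s, singE s)) +
    ∫⁻ x : Heis, ‖(log (1 + korN x) + (log 14 + log 2)) * |Ψ x|‖ₑ, ?_, fun q => ?_⟩
  · refine ENNReal.add_ne_top.2 ⟨?_, iL.2.ne⟩
    exact ENNReal.mul_ne_top ENNReal.ofReal_ne_top (ENNReal.mul_ne_top ENNReal.ofReal_ne_top
      (ENNReal.mul_ne_top ENNReal.ofReal_ne_top lintegral_singE_ne_top))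
  let h : ℝ → ℝ → ℝ := fun a b => q.2.2 + 2 * (q.2.1 * a - q.1 * b)
  have hh : Measurable (Function.uncurry h) := by
    simp only [Function.uncurry_def, h]; fun_prop
  have mI : Measurable ((Icc (-M) M).indicator (1 : ℝ → ℝ≥0∞)) :=
    measurable_one.indicator measurableSet_Icc
  have ms : Measurable fun x : Heis => (Icc (-M) M).indicator (1 : ℝ → ℝ≥0∞) x.1 *
      ((Icc (-M) M).indicator 1 x.2.1 * singE (x.2.2 + h x.1 x.2.1)) := by
    have hh3 : Measurable fun x : ℝ × ℝ × ℝ => h x.1 x.2.1 :=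
      hh.comp (measurable_fst.prodMk (measurable_fst.comp measurable_snd))
    exact (mI.comp measurable_fst).mul ((mI.comp (measurable_fst.comp measurable_snd)).mul
      (measurable_singE.comp ((measurable_snd.comp measurable_snd).add hh3)))
  calc ∫⁻ x, ‖(log (korN (Hmul q x)) - log (1 + korN q)) * Ψ x‖ₑ
      ≤ ∫⁻ x : Heis, (ENNReal.ofReal B * ((Icc (-M) M).indicator 1 x.1 *
          ((Icc (-M) M).indicator 1 x.2.1 * singE (x.2.2 + h x.1 x.2.1))) +
          ‖(log (1 + korN x) + (log 14 + log 2)) * |Ψ x|‖ₑ) := by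
        refine lintegral_mono fun x => ?_
        by_cases hx : x ∈ tsupport Ψ
        · have hn := hM x hx
          rw [Prod.norm_def, Prod.norm_def, sup_le_iff, sup_le_iff] at hn
          have m1 : x.1 ∈ Icc (-M) M := abs_le.1 hn.1
          have m2 : x.2.1 ∈ Icc (-M) M := abs_le.1 hn.2.1
          rw [indicator_of_mem m1, indicator_of_mem m2, Pi.one_apply, Pi.one_apply, one_mul, one_mul]
          have e1 := enorm_log_korN_sub_le (Hmul q x)
          have e2 := abs_log_one_add_korN_Hmul_sub_le q x
          have e3 : (Hmul q x).2.2 = x.2.2 + h x.1 x.2.1 := by simp only [Hmul, h]; ring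
          rw [e3] at e1
          have hx0 := korN_nonneg x
          have l0 : 0 ≤ log (1 + korN x) := log_nonneg (by linarith)
          have l1 : 0 ≤ log 14 := log_nonneg (by norm_num)
          have l2 : 0 ≤ log 2 := log_nonneg (by norm_num)
          have e4 : ‖log (1 + korN (Hmul q x)) - log (1 + korN q)‖ₑ ≤
              ENNReal.ofReal (log 14 + log (1 + korN x)) := by
            rw [← ofReal_norm]; exact ENNReal.ofReal_le_ofReal e2
          have e5 : ‖log (korN (Hmul q x)) - log (1 + korN q)‖ₑ ≤
              singE (x.2.2 + h x.1 x.2.1) +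
                ENNReal.ofReal (log (1 + korN x) + (log 14 + log 2)) := by
            rw [← sub_add_sub_cancel _ (log (1 + korN (Hmul q x)))]
            refine (enorm_add_le _ _).trans ((add_le_add e1 e4).trans ?_)
            rw [add_assoc, ← ENNReal.ofReal_add l2 (by positivity)]
            exact add_le_add le_rfl (ENNReal.ofReal_le_ofReal (by linarith))
          have hb : ‖Ψ x‖ₑ ≤ ENNReal.ofReal B := by
            rw [← ofReal_norm]; exact ENNReal.ofReal_le_ofReal (hB x)
          rw [enorm_mul, enorm_mul, Real.enorm_abs]
          calc _ ≤ (singE (x.2.2 + h x.1 x.2.1) +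
                ENNReal.ofReal (log (1 + korN x) + (log 14 + log 2))) * ‖Ψ x‖ₑ := by gcongr
            _ ≤ _ := by
              rw [add_mul, mul_comm (ENNReal.ofReal B),
                Real.enorm_of_nonneg (show 0 ≤ log (1 + korN x) + (log 14 + log 2) by positivity)]
              gcongr
        · rw [image_eq_zero_of_notMem_tsupport hx]; simp
    _ ≤ _ := by
      rw [lintegral_add_left (ms.const_mul _), lintegral_const_mul _ ms]
      gcongr
      exact lintegral_singE_shear_le M hh

theorem measurable_log_korN_Hmul {α : Type*} [MeasurableSpace α] {q x : α → Heis}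
    (hq : Measurable q) (hx : Measurable x) : Measurable fun a => log (korN (Hmul (q a) (x a))) := by
  refine measurable_log.comp (continuous_korN.measurable.comp ?_)
  unfold Hmul
  fun_prop

theorem measurable_log_one_add_korN : Measurable fun p => log (1 + korN p) :=
  measurable_log.comp (measurable_const.add continuous_korN.measurable)

theorem continuous_log_one_add_korN : Continuous fun p => log (1 + korN p) :=
  (continuous_const.add continuous_korN).log fun x =>
    (add_pos_of_pos_of_nonneg one_pos (korN_nonneg x)).ne'

theorem integrable_log_korN_Hmul_mul {Ψ : Heis → ℝ} (hΨ : Continuous Ψ)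
    (hc : HasCompactSupport Ψ) (q : Heis) :
    Integrable fun x => (log (korN (Hmul q x)) - log (1 + korN q)) * Ψ x := by
  obtain ⟨C, hC, h⟩ := exists_lintegral_log_korN_Hmul_le hΨ hc
  refine ⟨?_, (h q).trans_lt hC.lt_top⟩
  exact (((measurable_log_korN_Hmul measurable_const measurable_id).sub_const _).mul
    hΨ.measurable).aestronglyMeasurable

theorem integrable_log_korN_mul {Ψ : Heis → ℝ} (hΨ : Continuous Ψ)
    (hc : HasCompactSupport Ψ) : Integrable fun x => log (korN x) * Ψ x := by
  have := integrable_log_korN_Hmul_mul hΨ hc 0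
  have e : ∀ x, Hmul 0 x = x := fun x => by ext <;> simp [Hmul]
  have e0 : korN 0 = 0 := by simp [korN]
  simpa [e, e0] using this

theorem locallyIntegrable_log_korN : LocallyIntegrable fun x => log (korN x) := by
  intro x
  let f : ContDiffBump x := ⟨1, 2, one_pos, one_lt_two⟩
  refine ⟨Metric.ball x 1, Metric.ball_mem_nhds x one_pos, ?_⟩
  refine (integrable_log_korN_mul f.continuous f.hasCompactSupport).integrableOn.congr_fun
    (fun y hy => ?_) measurableSet_ball
  simp only
  rw [f.one_of_mem_closedBall (Metric.ball_subset_closedBall hy), mul_one]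

theorem integrable_log_korN_sub_mul {f : Heis → ℝ} (hf : Continuous f) (hi : Integrable f) :
    Integrable fun y => (log (korN y) - log (1 + korN y)) * f y := by
  let φ : ContDiffBump (0 : Heis) := ⟨1, 2, one_pos, one_lt_two⟩
  have hc : HasCompactSupport fun y => φ y * f y := φ.hasCompactSupport.mul_right
  have hφf : Continuous fun y => φ y * f y := φ.continuous.mul hf
  have i1 := integrable_log_korN_mul hφf hc
  have i2 : Integrable fun y => log (1 + korN y) * (φ y * f y) :=
    (continuous_log_one_add_korN.mul hφf).integrable_of_hasCompactSupport hc.mul_left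
  have i3 : Integrable fun y => ((log (korN y) - log (1 + korN y)) * (1 - φ y)) * f y := by
    refine hi.bdd_mul (c := log 2) ?_ (Eventually.of_forall fun y => ?_)
    · exact (((measurable_log.comp continuous_korN.measurable).sub
        measurable_log_one_add_korN).mul
        (measurable_const.sub φ.continuous.measurable)).aestronglyMeasurable
    · by_cases hy : y ∈ Metric.closedBall (0 : Heis) 1
      · rw [φ.one_of_mem_closedBall hy]; simp [log_nonneg one_le_two]
      · rw [mem_closedBall_zero_iff, not_le] at hy
        rw [norm_mul, ← mul_one (log 2)]
        gcongr
        · exact log_one_add_sub_log_le (one_le_korN hy.le)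
        · rw [Real.norm_of_nonneg (sub_nonneg.2 φ.le_one)]
          linarith [φ.nonneg (x := y)]
  refine ((i1.sub i2).add i3).congr (Eventually.of_forall fun y => ?_)
  simp only [Pi.add_apply, Pi.sub_apply]
  ring

theorem tendsto_log_add_sq_sub (A B : ℝ) :
    Tendsto (fun n : ℕ => log (A + (n + B) ^ 2) - log ((n : ℝ) ^ 2)) atTop (𝓝 0) := by
  have hinv : Tendsto (fun n : ℕ => ((n : ℝ))⁻¹) atTop (𝓝 0) := tendsto_inv_atTop_nhds_zero_nat
  have h1 : Tendsto (fun n : ℕ => A * ((n : ℝ)⁻¹) ^ 2 + (1 + B * (n : ℝ)⁻¹) ^ 2) atTop (𝓝 1) := by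
    have := ((hinv.pow 2).const_mul A).add (((hinv.const_mul B).const_add 1).pow 2)
    simpa using this
  have h2 := (continuousAt_log one_ne_zero).tendsto.comp h1
  rw [log_one] at h2
  refine h2.congr' ?_
  filter_upwards [eventually_gt_atTop 0, h1.eventually (lt_mem_nhds one_pos)] with n hn hpos
  have hn' : (0 : ℝ) < n := by exact_mod_cast hn
  have e : A + (n + B) ^ 2 = (A * ((n : ℝ)⁻¹) ^ 2 + (1 + B * (n : ℝ)⁻¹) ^ 2) * (n : ℝ) ^ 2 := by
    field_simp
  rw [Function.comp_apply, e, log_mul hpos.ne' (by positivity)]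
  ring

theorem Hmul_Hinv_add_vert (y x : Heis) (s : ℝ) :
    Hmul (Hinv y) (x + s • ((0, 0, 1) : Heis)) = Hmul (-y.1, -y.2.1, s - y.2.2) x := by
  ext <;> simp [Hmul, Hinv]; ring

theorem tendsto_integral_log_korN_Hmul {Ψ : Heis → ℝ} (hΨ : Continuous Ψ)
    (hc : HasCompactSupport Ψ) (y : Heis) :
    Tendsto (fun n : ℕ => ∫ x, (log (korN (Hmul (-y.1, -y.2.1, n - y.2.2) x)) -
      log (1 + korN (-y.1, -y.2.1, n - y.2.2))) * Ψ x) atTop (𝓝 0) := by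
  obtain ⟨M, hM⟩ := hc.isCompact.isBounded.exists_norm_le
  have hL : Continuous fun x : Heis => (log (1 + korN x) + (log 14 + log 2)) * |Ψ x| :=
    (continuous_log_one_add_korN.add continuous_const).mul hΨ.abs
  have iL : Integrable fun x : Heis => (log (1 + korN x) + (log 14 + log 2)) * |Ψ x| :=
    hL.integrable_of_hasCompactSupport hc.abs.mul_left
  rw [← integral_zero Heis ℝ]
  refine tendsto_integral_filter_of_dominated_convergence _ (Eventually.of_forall fun n =>
    (integrable_log_korN_Hmul_mul hΨ hc _).1) ?_ iL (Eventually.of_forall fun x => ?_)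
  · filter_upwards [(tendsto_natCast_atTop_atTop (R := ℝ)).eventually_gt_atTop
      (1 + |y.2.2| + M + 2 * (|y.2.1| * M + |y.1| * M))] with n hn
    refine Eventually.of_forall fun x => ?_
    by_cases hx : x ∈ tsupport Ψ
    · have hnx := hM x hx
      rw [Prod.norm_def, Prod.norm_def, sup_le_iff, sup_le_iff] at hnx
      obtain ⟨h1, h2, h3⟩ := hnx
      rw [Real.norm_eq_abs] at h1 h2 h3
      rw [norm_mul, Real.norm_eq_abs, Real.norm_eq_abs]
      gcongr
      set q : Heis := (-y.1, -y.2.1, n - y.2.2) with hq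
      have hq1 : 1 ≤ korN (Hmul q x) := by
        have a1 : |y.2.1 * x.1| ≤ |y.2.1| * M := by rw [abs_mul]; gcongr
        have a2 : |y.1 * x.2.1| ≤ |y.1| * M := by rw [abs_mul]; gcongr
        have b1 := abs_le.1 a1
        have b2 := abs_le.1 a2
        have b3 := abs_le.1 h3
        have b4 := le_abs_self y.2.2
        have : 1 ≤ (Hmul q x).2.2 := by
          simp only [Hmul, hq]
          linarith [b1.2, b2.1, b3.1]
        unfold korN
        nlinarith [sq_nonneg ((Hmul q x).1 ^ 2 + (Hmul q x).2.1 ^ 2)]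
      have e1 := log_one_add_sub_log_le hq1
      have e2 := abs_log_one_add_korN_Hmul_sub_le q x
      rw [← sub_add_sub_cancel _ (log (1 + korN (Hmul q x)))]
      exact (abs_add_le _ _).trans (by linarith)
    · rw [image_eq_zero_of_notMem_tsupport hx]; simp
  · have t1 := tendsto_log_add_sq_sub (((-y.1 + x.1) ^ 2 + (-y.2.1 + x.2.1) ^ 2) ^ 2)
      (-y.2.2 + x.2.2 + 2 * (-y.2.1 * x.1 - -y.1 * x.2.1))
    have t2 := tendsto_log_add_sq_sub (1 + ((-y.1) ^ 2 + (-y.2.1) ^ 2) ^ 2) (-y.2.2)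
    have t3 := (t1.sub t2).mul_const (Ψ x)
    simp only [sub_zero, zero_mul] at t3
    refine t3.congr fun n => ?_
    rw [sub_sub_sub_cancel_right]
    simp only [korN, Hmul]
    congr 2
    · congr 1; ring
    · congr 1; ring

end KoranyiLog

section VerticalLimit
open Filter Topology Set
open scoped ENNReal

theorem Hmul_Hinv_ne_zero {y z : Heis} (h : y ≠ z) : Hmul (Hinv y) z ≠ 0 := by
  intro h0
  apply h
  simp only [Hmul, Hinv, Prod.ext_iff, Prod.fst_zero, Prod.snd_zero] at h0
  obtain ⟨h1, h2, h3⟩ := h0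
  have e1 : y.1 = z.1 := by linarith
  have e2 : y.2.1 = z.2.1 := by linarith
  rw [e1, e2] at h3
  exact Prod.ext e1 (Prod.ext e2 (by linarith))

theorem log_rho_div_Hmul_Hinv {y z : Heis} (hy : y ≠ 0) (hz : y ≠ z) :
    log (rho y / rho (Hmul (Hinv y) z)) =
      (log (korN y) - log (korN (Hmul (Hinv y) z))) / 4 :=
  log_rho_div hy (Hmul_Hinv_ne_zero hz)

theorem integrable_log_korN_sub_log_one_add_mul {f : Heis → ℝ} (hf : Continuous f)
    (hi : Integrable f) (s : ℝ) :
    Integrable fun y => (log (korN y) - log (1 + korN (-y.1, -y.2.1, s - y.2.2))) * f y := by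
  have e : ∀ y : Heis, ((-y.1, -y.2.1, s - y.2.2) : Heis) = Hmul (Hinv y) (0, 0, s) := fun y => by
    ext <;> simp [Hmul, Hinv]; ring
  have h2 : Integrable fun y : Heis =>
      (log (1 + korN y) - log (1 + korN (-y.1, -y.2.1, s - y.2.2))) * f y := by
    refine hi.bdd_mul (c := log 14 + log (1 + korN (0, 0, s))) ?_ (Eventually.of_forall fun y => ?_)
    · refine (continuous_log_one_add_korN.sub
        (continuous_log_one_add_korN.comp (by fun_prop))).aestronglyMeasurable
    · rw [e, ← korN_Hinv y, Real.norm_eq_abs, abs_sub_comm]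
      exact abs_log_one_add_korN_Hmul_sub_le _ _
  refine ((integrable_log_korN_sub_mul hf hi).add h2).congr (Eventually.of_forall fun y => ?_)
  simp only [Pi.add_apply]
  ring

theorem integrable_prod_log_korN_Hmul_mul {f Ψ : Heis → ℝ} (hf : Continuous f) (hi : Integrable f)
    (hΨ : Continuous Ψ) (hc : HasCompactSupport Ψ) {q : Heis → Heis} (hq : Measurable q) :
    Integrable (fun z : Heis × Heis =>
      (log (korN (Hmul (q z.2) z.1)) - log (1 + korN (q z.2))) * Ψ z.1 * f z.2)
      (volume.prod volume) := by
  obtain ⟨C, hC, hb⟩ := exists_lintegral_log_korN_Hmul_le hΨ hc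
  have hm : Measurable (fun z : Heis × Heis =>
      (log (korN (Hmul (q z.2) z.1)) - log (1 + korN (q z.2))) * Ψ z.1 * f z.2) :=
    (((measurable_log_korN_Hmul (hq.comp measurable_snd) measurable_fst).sub
      (measurable_log_one_add_korN.comp (hq.comp measurable_snd))).mul
      (hΨ.measurable.comp measurable_fst)).mul (hf.measurable.comp measurable_snd)
  refine ⟨hm.aestronglyMeasurable, ?_⟩
  rw [HasFiniteIntegral, lintegral_prod_symm _ hm.enorm.aemeasurable]
  calc _ ≤ ∫⁻ y, C * ‖f y‖ₑ := by
        refine lintegral_mono fun y => ?_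
        simp only [enorm_mul _ (f y)]
        rw [lintegral_mul_const']
        · gcongr
          exact hb (q y)
        · exact enorm_ne_top
    _ = C * ∫⁻ y, ‖f y‖ₑ := lintegral_const_mul _ hf.measurable.enorm
    _ < ⊤ := ENNReal.mul_lt_top hC.lt_top hi.2

theorem integral_potential_vert_mul {f Ψ : Heis → ℝ} (hf : Continuous f) (hi : Integrable f)
    (hΨ : Continuous Ψ) (hc : HasCompactSupport Ψ) (h0 : ∫ x, Ψ x = 0) (s : ℝ) :
    ∫ x, (∫ y, log (rho y / rho (Hmul (Hinv y) (x + s • ((0, 0, 1) : Heis)))) * f y) * Ψ x =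
      -(1 / 4) * ∫ y, (∫ x, (log (korN (Hmul (-y.1, -y.2.1, s - y.2.2) x)) -
      log (1 + korN (-y.1, -y.2.1, s - y.2.2))) * Ψ x) * f y := by
  set h : Heis → ℝ := fun y => (log (korN y) - log (1 + korN (-y.1, -y.2.1, s - y.2.2))) * f y
    with hh
  have ih : Integrable h := integrable_log_korN_sub_log_one_add_mul hf hi s
  set G : Heis × Heis → ℝ := fun z =>
      (log (korN (Hmul (-z.2.1, -z.2.2.1, s - z.2.2.2) z.1)) -
        log (1 + korN (-z.2.1, -z.2.2.1, s - z.2.2.2))) * Ψ z.1 * f z.2 with hG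
  have iG : Integrable G (volume.prod volume) :=
    integrable_prod_log_korN_Hmul_mul hf hi hΨ hc
      (q := fun y => (-y.1, -y.2.1, s - y.2.2)) (by fun_prop)
  have key : ∀ᵐ x : Heis, (∫ y, log (rho y / rho (Hmul (Hinv y) (x + s • ((0, 0, 1) : Heis)))) *
      f y) * Ψ x = 1 / 4 * ((∫ y, h y) * Ψ x - ∫ y, G (x, y)) := by
    filter_upwards [iG.prod_right_ae] with x hx
    rw [← integral_mul_const, ← integral_mul_const, ← integral_sub (ih.mul_const _) hx,
      ← integral_const_mul]
    refine integral_congr_ae ?_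
    have n0 : ∀ᵐ y : Heis, y ≠ 0 := by simp [ae_iff]
    have n1 : ∀ᵐ y : Heis, y ≠ x + s • ((0, 0, 1) : Heis) := by simp [ae_iff]
    filter_upwards [n0, n1] with y hy0 hy1
    rw [log_rho_div_Hmul_Hinv hy0 hy1, Hmul_Hinv_add_vert]
    simp only [hh, hG]
    ring
  rw [integral_congr_ae key, integral_const_mul, integral_sub, integral_const_mul, h0,
    integral_integral_swap (f := fun x y => G (x, y)) iG]
  · simp only [hG, integral_mul_const]
    ring
  · exact (hΨ.integrable_of_hasCompactSupport hc).const_mul _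
  · exact iG.integral_prod_left

theorem tendsto_integral_potential_vert_mul {f Ψ : Heis → ℝ} (hf : Continuous f)
    (hi : Integrable f) (hΨ : Continuous Ψ) (hc : HasCompactSupport Ψ) (h0 : ∫ x, Ψ x = 0) :
    Tendsto (fun n : ℕ => ∫ x, (∫ y, log (rho y / rho (Hmul (Hinv y)
      (x + (n : ℝ) • ((0, 0, 1) : Heis)))) * f y) * Ψ x) atTop (𝓝 0) := by
  simp_rw [integral_potential_vert_mul hf hi hΨ hc h0]
  obtain ⟨C, hC, hb⟩ := exists_lintegral_log_korN_Hmul_le hΨ hc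
  suffices Tendsto (fun n : ℕ => ∫ y : Heis, (∫ x, (log (korN (Hmul (-y.1, -y.2.1, n - y.2.2) x)) -
      log (1 + korN (-y.1, -y.2.1, n - y.2.2))) * Ψ x) * f y) atTop (𝓝 (∫ _ : Heis, (0 : ℝ))) by
    have h1 := this.const_mul (-(1 / 4 : ℝ))
    rwa [integral_zero, mul_zero] at h1
  refine tendsto_integral_of_dominated_convergence (fun y => C.toReal * ‖f y‖) (fun n => ?_)
    (hi.norm.const_mul _) (fun n => Eventually.of_forall fun y => ?_)
    (Eventually.of_forall fun y => ?_)
  · have := (integrable_prod_log_korN_Hmul_mul hf hi hΨ hc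
      (q := fun y => (-y.1, -y.2.1, n - y.2.2)) (by fun_prop)).integral_prod_right.1
    simpa only [integral_mul_const] using this
  · rw [norm_mul]
    gcongr
    refine (norm_integral_le_lintegral_norm _).trans (ENNReal.toReal_mono hC ?_)
    simpa only [ofReal_norm] using hb _
  · simpa using (tendsto_integral_log_korN_Hmul hΨ hc y).mul_const (f y)

end VerticalLimit

section PotentialDifferentiable
open Filter Topology Set
open scoped ENNReal Convolution

/-- The vertical shear turning Heisenberg convolution into Euclidean convolution. -/
def shear (p s : Heis) : Heis := (s.1, s.2.1, s.2.2 + 2 * (p.2.1 * s.1 - p.1 * s.2.1))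

theorem Hmul_Hinv_shear (x s : Heis) : Hmul (Hinv (shear x s)) x = x - s := by
  ext <;> simp [Hmul, Hinv, shear] <;> ring

theorem measurePreserving_shear (p : Heis) : MeasurePreserving (shear p) := by
  have h1 : ∀ a : ℝ, MeasurePreserving
      (fun s : ℝ × ℝ => (s.1, s.2 + 2 * (p.2.1 * a - p.1 * s.1))) (volume.prod volume)
      (volume.prod volume) := fun a =>
    (MeasurePreserving.id volume).skew_product
      (g := fun b t => t + 2 * (p.2.1 * a - p.1 * b)) (by fun_prop)
      (Eventually.of_forall fun b => (measurePreserving_add_right volume _).map_eq)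
  exact (MeasurePreserving.id (volume : Measure ℝ)).skew_product (μd := (volume : Measure (ℝ × ℝ)))
    (g := fun a (s : ℝ × ℝ) => (s.1, s.2 + 2 * (p.2.1 * a - p.1 * s.1))) (by fun_prop)
    (Eventually.of_forall fun a => (h1 a).map_eq)

theorem differentiableAt_integral_log_korN_mul {φ : Heis → ℝ} (hφ : ContDiff ℝ 1 φ)
    (hc : HasCompactSupport φ) (x₀ : Heis) :
    DifferentiableAt ℝ (fun x => ∫ y, φ y * log (korN (Hmul (Hinv y) x))) x₀ := by
  obtain ⟨M, hM⟩ := hc.isCompact.isBounded.exists_norm_le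
  have e : ∀ x, ∫ y, φ y * log (korN (Hmul (Hinv y) x)) =
      ((fun s => φ (shear x s)) ⋆[ContinuousLinearMap.lsmul ℝ ℝ, volume]
        fun x => log (korN x)) x := by
    intro x
    rw [convolution_def]
    simp only [ContinuousLinearMap.lsmul_apply, smul_eq_mul]
    have hm : Measurable fun y => φ y * log (korN (Hmul (Hinv y) x)) :=
      hφ.continuous.measurable.mul
        (measurable_log_korN_Hmul (by unfold Hinv; fun_prop) measurable_const)
    have hs := measurePreserving_shear x
    rw [← hs.map_eq, integral_map hs.measurable.aemeasurable hm.aestronglyMeasurable, hs.map_eq]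
    simp_rw [Hmul_Hinv_shear]
  simp_rw [e]
  have hd := contDiffOn_convolution_left_with_param_comp (𝕜 := ℝ) (μ := (volume : Measure Heis))
    (n := 1) (s := Metric.ball x₀ 1) (v := fun x : Heis => x)
    (k := Metric.closedBall 0 (M + 4 * (‖x₀‖ + 1) * M)) (f := fun x : Heis => log (korN x))
    (g := fun p s => φ (shear p s)) (ContinuousLinearMap.lsmul ℝ ℝ) contDiffOn_id
    Metric.isOpen_ball (isCompact_closedBall _ _) ?_ locallyIntegrable_log_korN ?_
  · exact (hd.contDiffAt (Metric.ball_mem_nhds x₀ one_pos)).differentiableAt one_ne_zero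
  · intro p s hp hs
    by_contra h0
    apply hs
    have hn := hM _ (subset_tsupport _ h0)
    simp only [shear, Prod.norm_def, sup_le_iff, Real.norm_eq_abs] at hn
    obtain ⟨h1, h2, h3⟩ := hn
    have hp' : ‖p‖ ≤ ‖x₀‖ + 1 := by
      rw [mem_ball_iff_norm] at hp
      have := norm_le_insert' p x₀
      linarith
    set R := ‖x₀‖ + 1 with hR
    simp only [Prod.norm_def (x := p), Prod.norm_def (x := p.2), sup_le_iff, Real.norm_eq_abs] at hp'
    obtain ⟨p1, p2, -⟩ := hp'
    have hR0 : 0 ≤ R := by positivity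
    have hM0 : 0 ≤ M := (abs_nonneg _).trans h1
    have a1 : |p.2.1 * s.1| ≤ R * M := by rw [abs_mul]; gcongr
    have a2 : |p.1 * s.2.1| ≤ R * M := by rw [abs_mul]; gcongr
    have b1 := abs_le.1 a1
    have b2 := abs_le.1 a2
    have b3 := abs_le.1 h3
    have hRM : 0 ≤ R * M := by positivity
    simp only [mem_closedBall_zero_iff, Prod.norm_def, sup_le_iff, Real.norm_eq_abs]
    refine ⟨by linarith, by linarith, abs_le.2 ⟨?_, ?_⟩⟩ <;> linarith [b1.1, b1.2, b2.1, b2.2, b3.1, b3.2]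
  · refine (hφ.comp ?_).contDiffOn
    unfold shear
    fun_prop

theorem korN_Hmul_Hinv_comm (x y : Heis) :
    korN (Hmul (Hinv y) x) = korN (Hmul (Hinv x) y) := by
  rw [← korN_Hinv]
  congr 1
  ext
  all_goals
    simp [Hmul, Hinv]
    try ring

theorem integrable_mul_log_korN_Hmul_Hinv {φ : Heis → ℝ} (hφ : Continuous φ)
    (hc : HasCompactSupport φ) (x : Heis) :
    Integrable fun y => φ y * log (korN (Hmul (Hinv y) x)) := by
  have h1 := integrable_log_korN_Hmul_mul hφ hc (Hinv x)
  have h2 : Integrable fun y => log (1 + korN (Hinv x)) * φ y :=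
    (hφ.integrable_of_hasCompactSupport hc).const_mul _
  refine (h1.add h2).congr (Eventually.of_forall fun y => ?_)
  simp only [Pi.add_apply, korN_Hmul_Hinv_comm x y]
  ring

/-- The differential of `x ↦ log N(y⁻¹ x)`. -/
def dlogKor (x y : Heis) : Heis →L[ℝ] ℝ :=
  let h := Hmul (Hinv y) x
  ((4 * (h.1 ^ 2 + h.2.1 ^ 2) * h.1 - 4 * h.2.2 * y.2.1) / korN h) • ContinuousLinearMap.fst ℝ ℝ (ℝ × ℝ) +
  ((4 * (h.1 ^ 2 + h.2.1 ^ 2) * h.2.1 + 4 * h.2.2 * y.1) / korN h) •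
    (ContinuousLinearMap.fst ℝ ℝ ℝ ∘L ContinuousLinearMap.snd ℝ ℝ (ℝ × ℝ)) +
  (2 * h.2.2 / korN h) • (ContinuousLinearMap.snd ℝ ℝ ℝ ∘L ContinuousLinearMap.snd ℝ ℝ (ℝ × ℝ))

theorem hasFDerivAt_log_korN {x y : Heis} (h : 1 ≤ korN (Hmul (Hinv y) x)) :
    HasFDerivAt (fun x => log (korN (Hmul (Hinv y) x))) (dlogKor x y) x := by
  have d1 : HasFDerivAt (fun x : Heis => x.1) (ContinuousLinearMap.fst ℝ ℝ (ℝ × ℝ)) x :=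
    hasFDerivAt_fst
  have d2 : HasFDerivAt (fun x : Heis => x.2.1)
      (ContinuousLinearMap.fst ℝ ℝ ℝ ∘L ContinuousLinearMap.snd ℝ ℝ (ℝ × ℝ)) x :=
    (ContinuousLinearMap.fst ℝ ℝ ℝ ∘L ContinuousLinearMap.snd ℝ ℝ (ℝ × ℝ)).hasFDerivAt
  have d3 : HasFDerivAt (fun x : Heis => x.2.2)
      (ContinuousLinearMap.snd ℝ ℝ ℝ ∘L ContinuousLinearMap.snd ℝ ℝ (ℝ × ℝ)) x :=
    (ContinuousLinearMap.snd ℝ ℝ ℝ ∘L ContinuousLinearMap.snd ℝ ℝ (ℝ × ℝ)).hasFDerivAt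
  have a := d1.const_add (-y.1)
  have b := d2.const_add (-y.2.1)
  have c := (d3.const_add (-y.2.2)).add (((d1.const_mul (-y.2.1)).sub (d2.const_mul (-y.1))).const_mul 2)
  have N := (((a.pow 2).add (b.pow 2)).pow 2).add (c.pow 2)
  have L := N.log (ne_of_gt (lt_of_lt_of_le one_pos h))
  refine L.congr_fderiv ?_
  ext <;> simp [dlogKor, Hmul, Hinv, korN] <;> ring

theorem norm_dlogKor_le {x y : Heis} (h : 1 ≤ korN (Hmul (Hinv y) x)) :
    ‖dlogKor x y‖ ≤ 18 + 8 * ‖x‖ := by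
  have hx : ‖x‖ ≤ ‖x‖ := le_rfl
  rw [Prod.norm_def (x := x), Prod.norm_def (x := x.2), sup_le_iff, sup_le_iff,
    ← Prod.norm_def (x := x.2), ← Prod.norm_def (x := x)] at hx
  obtain ⟨hx1, hx2, -⟩ := hx
  set R := ‖x‖
  have hy1 : y.1 = x.1 - (Hmul (Hinv y) x).1 := by simp [Hmul, Hinv]
  have hy2 : y.2.1 = x.2.1 - (Hmul (Hinv y) x).2.1 := by simp [Hmul, Hinv]
  have p1 : ‖ContinuousLinearMap.fst ℝ ℝ (ℝ × ℝ)‖ ≤ 1 := ContinuousLinearMap.norm_fst_le _ _ _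
  have p2 : ‖ContinuousLinearMap.fst ℝ ℝ ℝ ∘L ContinuousLinearMap.snd ℝ ℝ (ℝ × ℝ)‖ ≤ 1 :=
    (ContinuousLinearMap.opNorm_comp_le _ _).trans (mul_le_one₀
      (ContinuousLinearMap.norm_fst_le _ _ _) (norm_nonneg _) (ContinuousLinearMap.norm_snd_le _ _ _))
  have p3 : ‖ContinuousLinearMap.snd ℝ ℝ ℝ ∘L ContinuousLinearMap.snd ℝ ℝ (ℝ × ℝ)‖ ≤ 1 :=
    (ContinuousLinearMap.opNorm_comp_le _ _).trans (mul_le_one₀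
      (ContinuousLinearMap.norm_snd_le _ _ _) (norm_nonneg _) (ContinuousLinearMap.norm_snd_le _ _ _))
  unfold dlogKor
  simp only
  rw [hy1, hy2]
  rw [Real.norm_eq_abs] at hx1 hx2
  generalize Hmul (Hinv y) x = q at *
  obtain ⟨a, b, t⟩ := q
  simp only
  have hN : korN (a, b, t) = (a ^ 2 + b ^ 2) ^ 2 + t ^ 2 := rfl
  have hN' := h
  rw [hN] at hN'
  have hNpos : 0 < korN (a, b, t) := by linarith
  have hR : 0 ≤ R := (abs_nonneg _).trans hx1
  have t1 : |t| ≤ korN (a, b, t) := by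
    rw [hN, abs_le]; constructor <;> nlinarith [sq_nonneg (t - 1), sq_nonneg (t + 1), sq_nonneg (a ^ 2 + b ^ 2)]
  have r1 : a ^ 2 + b ^ 2 ≤ korN (a, b, t) := by
    rw [hN]; nlinarith [sq_nonneg (a ^ 2 + b ^ 2 - 1), sq_nonneg t]
  have r2 : ∀ c : ℝ, c ^ 2 ≤ a ^ 2 + b ^ 2 → |(a ^ 2 + b ^ 2) * c| ≤ korN (a, b, t) := by
    intro c hc
    rw [abs_mul, abs_of_nonneg (by positivity)]
    have : |c| ≤ (1 + (a ^ 2 + b ^ 2)) / 2 := by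
      rw [abs_le]; constructor <;> nlinarith [sq_nonneg (c - 1), sq_nonneg (c + 1)]
    calc (a ^ 2 + b ^ 2) * |c| ≤ (a ^ 2 + b ^ 2) * ((1 + (a ^ 2 + b ^ 2)) / 2) := by gcongr
      _ ≤ _ := by rw [hN] at r1 ⊢; nlinarith [sq_nonneg t]
  have r3 : ∀ c : ℝ, c ^ 2 ≤ a ^ 2 + b ^ 2 → |t * c| ≤ korN (a, b, t) := by
    intro c hc
    rw [hN] at r1 ⊢
    rw [abs_le]; constructor <;>
      nlinarith [sq_nonneg (t - c), sq_nonneg (t + c), sq_nonneg (a ^ 2 + b ^ 2)]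
  have r4 : ∀ z : ℝ, |z| ≤ R → |t * z| ≤ korN (a, b, t) * R := by
    intro z hz; rw [abs_mul]; gcongr
  have ha : a ^ 2 ≤ a ^ 2 + b ^ 2 := by nlinarith [sq_nonneg b]
  have hb : b ^ 2 ≤ a ^ 2 + b ^ 2 := by nlinarith [sq_nonneg a]
  have key : ∀ {E : Heis →L[ℝ] ℝ} {c C : ℝ}, ‖E‖ ≤ 1 → |c| ≤ C * korN (a, b, t) →
      ‖(c / korN (a, b, t)) • E‖ ≤ C := by
    intro E c C hE hcC
    rw [norm_smul, Real.norm_eq_abs, abs_div, abs_of_pos hNpos]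
    have : |c| / korN (a, b, t) ≤ C := by rwa [div_le_iff₀ hNpos]
    have hC : 0 ≤ C := le_trans (by positivity) this
    calc _ ≤ C * 1 := by gcongr
      _ = C := mul_one C
  have k1 := key (c := 4 * (a ^ 2 + b ^ 2) * a - 4 * t * (x.2.1 - b)) (C := 8 + 4 * R) p1 (by
    have := abs_le.1 (r2 a ha)
    have := abs_le.1 (r3 b hb)
    have := abs_le.1 (r4 _ hx2)
    rw [abs_le]; constructor <;> linarith)
  have k2 := key (c := 4 * (a ^ 2 + b ^ 2) * b + 4 * t * (x.1 - a)) (C := 8 + 4 * R) p2 (by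
    have := abs_le.1 (r2 b hb)
    have := abs_le.1 (r3 a ha)
    have := abs_le.1 (r4 _ hx1)
    rw [abs_le]; constructor <;> linarith)
  have k3 := key (c := 2 * t) (C := 2) p3 (by rw [abs_mul, abs_two]; gcongr)
  refine (norm_add₃_le).trans ?_
  linarith

theorem aestronglyMeasurable_dlogKor (x : Heis) :
    AEStronglyMeasurable (fun y => dlogKor x y) volume := by
  have hq : Measurable fun y => Hmul (Hinv y) x := by unfold Hmul Hinv; fun_prop
  have hN : Measurable fun y => korN (Hmul (Hinv y) x) := continuous_korN.measurable.comp hq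
  unfold dlogKor
  simp only
  refine ((AEStronglyMeasurable.smul_const ?_ _).add (AEStronglyMeasurable.smul_const ?_ _)).add
    (AEStronglyMeasurable.smul_const ?_ _)
  all_goals
    refine Measurable.aestronglyMeasurable (Measurable.div ?_ hN)
    fun_prop

theorem one_le_korN_of_lt_norm_sub {x₀ x y : Heis} (hx : ‖x - x₀‖ < 1)
    (hy : 4 * ‖x₀‖ + 6 < ‖y - x₀‖) : 1 ≤ korN y ∧ 1 ≤ korN (Hmul (Hinv y) x) := by
  have h0 := norm_nonneg x₀
  constructor
  · apply one_le_korN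
    have := norm_sub_le y x₀
    linarith
  · apply one_le_korN
    by_contra! hlt
    have hn : ‖x‖ ≤ ‖x₀‖ + 1 := by have := norm_le_insert' x x₀; linarith
    set R := ‖x₀‖
    simp only [Prod.norm_def, sup_lt_iff, sup_le_iff, Real.norm_eq_abs, Hmul, Hinv, Prod.fst_sub,
      Prod.snd_sub] at hlt hn hx
    obtain ⟨l1, l2, l3⟩ := hlt
    obtain ⟨n1, n2, -⟩ := hn
    obtain ⟨x1, x2, x3⟩ := hx
    refine absurd hy (not_lt.2 ?_)
    have m1 : |(-y.1 + x.1) * x.2.1| ≤ 1 * (R + 1) := by rw [abs_mul]; gcongr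
    have m2 : |(-y.2.1 + x.2.1) * x.1| ≤ 1 * (R + 1) := by rw [abs_mul]; gcongr
    rw [abs_le] at m1 m2
    rw [abs_lt] at l1 l2 l3 x1 x2 x3
    simp only [Prod.norm_def, sup_le_iff, Real.norm_eq_abs, Prod.fst_sub, Prod.snd_sub, abs_le]
    refine ⟨⟨?_, ?_⟩, ⟨?_, ?_⟩, ?_, ?_⟩ <;> linarith [m1.1, m1.2, m2.1, m2.2, l3.1, l3.2, x3.1, x3.2]

theorem integrable_log_korN_sub_mul_of_far {f : Heis → ℝ} (hf : Continuous f) (hi : Integrable f)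
    {x : Heis} (h : ∀ y, f y ≠ 0 → 1 ≤ korN y ∧ 1 ≤ korN (Hmul (Hinv y) x)) :
    Integrable fun y => (log (korN y) - log (korN (Hmul (Hinv y) x))) * f y := by
  refine (hi.norm.const_mul (log 2 + log 2 + (log 14 + log (1 + korN x)))).mono' ?_
    (Eventually.of_forall fun y => ?_)
  · exact (((measurable_log.comp continuous_korN.measurable).sub
      (measurable_log_korN_Hmul (by unfold Hinv; fun_prop) measurable_const)).mul
      hf.measurable).aestronglyMeasurable
  · by_cases hy : f y = 0
    · simp [hy]
    · obtain ⟨h1, h2⟩ := h y hy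
      rw [norm_mul]
      gcongr
      rw [Real.norm_eq_abs]
      have e1 := abs_le.1 (log_one_add_sub_log_le h1)
      have e2 := abs_le.1 (log_one_add_sub_log_le h2)
      have e3 := abs_le.1 (abs_log_one_add_korN_Hmul_sub_le (Hinv y) x)
      rw [korN_Hinv] at e3
      rw [abs_le]; constructor <;> linarith [e1.1, e1.2, e2.1, e2.2, e3.1, e3.2]

theorem differentiableAt_integral_log_korN_sub_mul_of_far {f : Heis → ℝ} (hf : Continuous f)
    (hi : Integrable f) {x₀ : Heis} (h : ∀ y, f y ≠ 0 → 4 * ‖x₀‖ + 6 < ‖y - x₀‖) :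
    DifferentiableAt ℝ
      (fun x => ∫ y, (log (korN y) - log (korN (Hmul (Hinv y) x))) * f y) x₀ := by
  have hfar : ∀ x ∈ Metric.ball x₀ 1, ∀ y, f y ≠ 0 →
      1 ≤ korN y ∧ 1 ≤ korN (Hmul (Hinv y) x) := fun x hx y hy =>
    one_le_korN_of_lt_norm_sub (mem_ball_iff_norm.1 hx) (h y hy)
  have hball : Metric.ball x₀ 1 ∈ 𝓝 x₀ := Metric.ball_mem_nhds x₀ one_pos
  refine (hasFDerivAt_integral_of_dominated_of_fderiv_le (𝕜 := ℝ)
    (F' := fun x y => f y • (-dlogKor x y))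
    (bound := fun y => (18 + 8 * (‖x₀‖ + 1)) * ‖f y‖) hball ?_
    (integrable_log_korN_sub_mul_of_far hf hi (hfar x₀ (Metric.mem_ball_self one_pos))) ?_
    (Eventually.of_forall fun y x hx => ?_) (hi.norm.const_mul _)
    (Eventually.of_forall fun y x hx => ?_)).differentiableAt
  · filter_upwards [hball] with x hx
    exact (integrable_log_korN_sub_mul_of_far hf hi (hfar x hx)).1
  · exact hi.1.smul (aestronglyMeasurable_dlogKor x₀).neg
  · by_cases hy : f y = 0
    · simp [hy]
    · rw [norm_smul, norm_neg, mul_comm]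
      gcongr
      refine (norm_dlogKor_le (hfar x hx y hy).2).trans ?_
      have := norm_le_insert' x x₀
      rw [mem_ball_iff_norm] at hx
      linarith
  · by_cases hy : f y = 0
    · simpa [hy] using hasFDerivAt_const (0 : ℝ) x
    · exact ((hasFDerivAt_log_korN (hfar x hx y hy).2).const_sub _).mul_const _

theorem differentiable_potential {f : Heis → ℝ} (hf : ContDiff ℝ 1 f) (hi : Integrable f) :
    Differentiable ℝ fun x => ∫ y, log (rho y / rho (Hmul (Hinv y) x)) * f y := by
  intro x₀
  let χ : ContDiffBump x₀ := ⟨4 * ‖x₀‖ + 6, 4 * ‖x₀‖ + 7, by positivity, by linarith⟩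
  have hχ : ContDiff ℝ 1 χ := χ.contDiff
  set φ : Heis → ℝ := fun y => χ y * f y with hφ
  have cφ : ContDiff ℝ 1 φ := hχ.mul hf
  have sφ : HasCompactSupport φ := χ.hasCompactSupport.mul_right
  have iφ : Integrable φ := cφ.continuous.integrable_of_hasCompactSupport sφ
  set g : Heis → ℝ := fun y => f y - φ y with hg
  have cg : Continuous g := hf.continuous.sub cφ.continuous
  have ig : Integrable g := hi.sub iφ
  have far : ∀ y, g y ≠ 0 → 4 * ‖x₀‖ + 6 < ‖y - x₀‖ := by
    intro y hy
    by_contra! hle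
    apply hy
    simp only [hg, hφ]
    rw [χ.one_of_mem_closedBall (by rwa [mem_closedBall_iff_norm])]
    ring
  have d1 := differentiableAt_integral_log_korN_mul cφ sφ x₀
  have d2 := differentiableAt_integral_log_korN_sub_mul_of_far cg ig far
  have i0 := integrable_log_korN_mul cφ.continuous sφ
  refine ((((d1.const_sub (∫ y, log (korN y) * φ y)).add d2).const_mul (1 / 4 : ℝ))).congr_of_eventuallyEq ?_
  filter_upwards [Metric.ball_mem_nhds x₀ one_pos] with x hx
  have i1 := integrable_mul_log_korN_Hmul_Hinv cφ.continuous sφ x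
  have i2 := integrable_log_korN_sub_mul_of_far cg ig (x := x) fun y hy =>
    one_le_korN_of_lt_norm_sub (mem_ball_iff_norm.1 hx) (far y hy)
  simp only [Pi.add_apply]
  have i3 : Integrable fun y => log (korN y) * φ y - φ y * log (korN (Hmul (Hinv y) x)) := i0.sub i1
  rw [← integral_sub i0 i1, ← integral_add i3 i2, ← integral_const_mul]
  refine integral_congr_ae ?_
  have n0 : ∀ᵐ y : Heis, y ≠ 0 := by simp [ae_iff]
  have n1 : ∀ᵐ y : Heis, y ≠ x := by simp [ae_iff]
  filter_upwards [n0, n1] with y hy0 hy1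
  rw [log_rho_div_Hmul_Hinv hy0 hy1]
  simp only [hg]
  ring

end PotentialDifferentiable

section Rigidity
open Filter Topology Set
open scoped Convolution

theorem apply_add_vert_of_fderiv_const {w : Heis → ℝ} {c : ℝ} (hw : Differentiable ℝ w)
    (hwc : ∀ p, fderiv ℝ w p (0, 0, 1) = c) (x : Heis) (s : ℝ) :
    w (x + s • ((0, 0, 1) : Heis)) = w x + c * s := by
  have hd : ∀ s : ℝ, HasDerivAt (fun s : ℝ => w (x + s • ((0, 0, 1) : Heis)) - c * s) 0 s := by
    intro s
    have h1 : HasDerivAt (fun s : ℝ => x + s • ((0, 0, 1) : Heis)) (0, 0, 1) s := by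
      simpa using ((hasDerivAt_id s).smul_const ((0, 0, 1) : Heis)).const_add x
    have h2 := (hw (x + s • ((0, 0, 1) : Heis))).hasFDerivAt.comp_hasDerivAt s h1
    rw [hwc] at h2
    have h3 := h2.sub ((hasDerivAt_id s).const_mul c)
    rw [mul_one, sub_self] at h3
    exact h3
  have := is_const_of_deriv_eq_zero (fun s => (hd s).differentiableAt) (fun s => (hd s).deriv) s 0
  simp only [zero_smul, add_zero, mul_zero, sub_zero] at this
  linarith

/-- Euclidean convolution of `w` with `η`. -/
def mollify (w η : Heis → ℝ) (x : Heis) : ℝ := ∫ t, w t * η (x - t)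

theorem mollify_eq_convolution (w η : Heis → ℝ) :
    mollify w η = w ⋆[ContinuousLinearMap.lsmul ℝ ℝ, volume] η := rfl

theorem contDiff_mollify {w η : Heis → ℝ} (hw : Continuous w) (hη : ContDiff ℝ (⊤ : ℕ∞) η)
    (hc : HasCompactSupport η) : ContDiff ℝ (⊤ : ℕ∞) (mollify w η) :=
  hc.contDiff_convolution_right (ContinuousLinearMap.lsmul ℝ ℝ) hw.locallyIntegrable hη

theorem fderiv_mollify {w η : Heis → ℝ} (hw : Continuous w) (hη : ContDiff ℝ (⊤ : ℕ∞) η)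
    (hc : HasCompactSupport η) (x e : Heis) :
    fderiv ℝ (mollify w η) x e = mollify w (fun z => fderiv ℝ η z e) x := by
  have h1 : ContDiff ℝ 1 η := hη.of_le (by exact_mod_cast le_top)
  have hd := hc.hasFDerivAt_convolution_right (ContinuousLinearMap.lsmul ℝ ℝ)
    (μ := (volume : Measure Heis)) hw.locallyIntegrable h1 x
  rw [mollify_eq_convolution, hd.fderiv, convolution_precompR_apply _ hw.locallyIntegrable
    (hc.fderiv ℝ) (h1.continuous_fderiv one_ne_zero)]
  rfl

theorem fderiv_const_sub_apply {η : Heis → ℝ} (hη : Differentiable ℝ η) (x t e : Heis) :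
    fderiv ℝ (fun t => η (x - t)) t e = -fderiv ℝ η (x - t) e := by
  have h : HasFDerivAt (fun t => η (x - t)) _ t :=
    (hη (x - t)).hasFDerivAt.comp t ((hasFDerivAt_id t).const_sub x)
  rw [h.fderiv]
  simp

/-- The mollification of a function with constant vertical derivative, corrected so as to be the
mollified horizontal derivative. -/
def mollD (w η : Heis → ℝ) (c : ℝ) (a : Heis) (ℓ : Heis →L[ℝ] ℝ) (x : Heis) : ℝ :=
  fderiv ℝ (mollify w η) x a + c * (ℓ x - ∫ t, ℓ t * η t)

theorem integral_mul_fieldD_reflect {w η : Heis → ℝ} {c : ℝ} (hw : Differentiable ℝ w)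
    (hwc : ∀ p, fderiv ℝ w p (0, 0, 1) = c) (hη : ContDiff ℝ (⊤ : ℕ∞) η)
    (hc : HasCompactSupport η) (h1 : ∫ t, η t = 1) (a : Heis) {ℓ : Heis →L[ℝ] ℝ}
    (hℓ : ℓ (0, 0, 1) = 0) (x : Heis) :
    ∫ p, w p * fieldD a ℓ (fun t => η (x - t)) p = -mollD w η c a ℓ x := by
  have hη1 : ContDiff ℝ 1 η := hη.of_le (by exact_mod_cast le_top)
  have cΦ : ContDiff ℝ 1 fun t => η (x - t) := hη1.comp (contDiff_const.sub contDiff_id)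
  have sΦ : HasCompactSupport fun t => η (x - t) :=
    hc.comp_homeomorph (Homeomorph.subLeft x)
  rw [integral_mul_fieldD_of_fderiv_const hw hwc cΦ sΦ a hℓ, mollD,
    fderiv_mollify hw.continuous hη hc, mollify]
  simp_rw [fderiv_const_sub_apply (hη1.differentiable one_ne_zero)]
  have e1 : ∫ t, ℓ t * η (x - t) = ∫ t, ℓ (x - t) * η t := by
    rw [← integral_sub_left_eq_self (fun t => ℓ t * η (x - t)) volume x]
    simp
  have i1 : Integrable η := hη.continuous.integrable_of_hasCompactSupport hc
  have i2 : Integrable fun t => ℓ t * η t :=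
    (ℓ.continuous.mul hη.continuous).integrable_of_hasCompactSupport hc.mul_left
  simp_rw [map_sub, sub_mul] at e1
  rw [integral_sub (i1.const_mul _) i2, integral_const_mul, h1, mul_one] at e1
  rw [e1]
  simp_rw [mul_neg]
  rw [integral_neg]
  ring

theorem integral_mul_fieldD_fieldD_reflect {w η : Heis → ℝ} {c : ℝ} (hw : Differentiable ℝ w)
    (hwc : ∀ p, fderiv ℝ w p (0, 0, 1) = c) (hη : ContDiff ℝ (⊤ : ℕ∞) η)
    (hc : HasCompactSupport η) {a : Heis} {ℓ : Heis →L[ℝ] ℝ}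
    (hℓ : ℓ (0, 0, 1) = 0) (ha : ℓ a = 0) (x : Heis) :
    ∫ p, w p * fieldD a ℓ (fieldD a ℓ fun t => η (x - t)) p =
      fderiv ℝ (fun z => fderiv ℝ (mollify w η) z a) x a := by
  have cΦ : ContDiff ℝ (⊤ : ℕ∞) fun t => η (x - t) := hη.comp (contDiff_const.sub contDiff_id)
  have sΦ : HasCompactSupport fun t => η (x - t) :=
    hc.comp_homeomorph (Homeomorph.subLeft x)
  have dη : ContDiff ℝ (⊤ : ℕ∞) fun z => fderiv ℝ η z a := hη.fderiv_apply_const a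
  have top0 : ((⊤ : ℕ∞) : WithTop ℕ∞) ≠ 0 := by simp
  rw [integral_mul_fieldD_fieldD_of_fderiv_const hw hwc cΦ sΦ hℓ ha,
    funext fun z => fderiv_mollify hw.continuous hη hc z a,
    fderiv_mollify hw.continuous dη (hc.fderiv_apply ℝ a), mollify]
  congr 1
  funext t
  rw [funext fun q => fderiv_const_sub_apply (hη.differentiable top0) x q a, fderiv_fun_neg]
  simp [fderiv_const_sub_apply (dη.differentiable top0)]

theorem contDiff_mollD {w η : Heis → ℝ} (hw : Continuous w) (hη : ContDiff ℝ (⊤ : ℕ∞) η)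
    (hc : HasCompactSupport η) (c : ℝ) (a : Heis) (ℓ : Heis →L[ℝ] ℝ) :
    ContDiff ℝ (⊤ : ℕ∞) (mollD w η c a ℓ) :=
  ((contDiff_mollify hw hη hc).fderiv_apply_const a).add
    (contDiff_const.mul (ℓ.contDiff.sub contDiff_const))

theorem fderiv_mollD {w η : Heis → ℝ} (hw : Continuous w) (hη : ContDiff ℝ (⊤ : ℕ∞) η)
    (hc : HasCompactSupport η) (c : ℝ) (a : Heis) (ℓ : Heis →L[ℝ] ℝ) (x e : Heis) :
    fderiv ℝ (mollD w η c a ℓ) x e =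
      fderiv ℝ (fun z => fderiv ℝ (mollify w η) z a) x e + c * ℓ e := by
  have h1 := (((contDiff_mollify hw hη hc).fderiv_apply_const a).differentiable (by simp) x).hasFDerivAt
  have h2 := (ℓ.hasFDerivAt (x := x)).sub_const (∫ t, ℓ t * η t)
  have h3 : HasFDerivAt (mollD w η c a ℓ) _ x := h1.add (h2.const_mul c)
  rw [h3.fderiv]
  simp

/-- The distributional form, tested on nonnegative functions, of
`-Δ_b w - 2 b · ∇_b w + |b|² ≥ 0` for all `b`. -/
def WeakRiccati (w : Heis → ℝ) : Prop :=
  ∀ Φ : Heis → ℝ, ContDiff ℝ (⊤ : ℕ∞) Φ → HasCompactSupport Φ → (∀ p, 0 ≤ Φ p) →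
    ∀ b₁ b₂ : ℝ, 0 ≤ (∫ p, w p * testOp b₁ b₂ Φ p) + (b₁ ^ 2 + b₂ ^ 2) * ∫ p, Φ p

theorem WeakRiccati.fderiv_mollD_add_le {w η : Heis → ℝ} {c : ℝ} (h : WeakRiccati w)
    (hw : Differentiable ℝ w) (hwc : ∀ p, fderiv ℝ w p (0, 0, 1) = c)
    (hη : ContDiff ℝ (⊤ : ℕ∞) η) (hc : HasCompactSupport η) (h0 : ∀ t, 0 ≤ η t)
    (h1 : ∫ t, η t = 1) (x : Heis) :
    fderiv ℝ (mollD w η c (1, 0, 0) ellX) x (1, 0, 0) +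
      fderiv ℝ (mollD w η c (0, 1, 0) ellY) x (0, 1, 0) +
      (mollD w η c (1, 0, 0) ellX x ^ 2 + mollD w η c (0, 1, 0) ellY x ^ 2) ≤ 0 := by
  set P := mollD w η c (1, 0, 0) ellX x with hP
  set Q := mollD w η c (0, 1, 0) ellY x with hQ
  set Φ : Heis → ℝ := fun t => η (x - t) with hΦ
  have cΦ : ContDiff ℝ (⊤ : ℕ∞) Φ := hη.comp (contDiff_const.sub contDiff_id)
  have sΦ : HasCompactSupport Φ := hc.comp_homeomorph (Homeomorph.subLeft x)
  have key := h Φ cΦ sΦ (fun t => h0 _) P Q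
  have iΦ : ∫ p, Φ p = 1 := by rw [hΦ, integral_sub_left_eq_self (fun t => η t) volume x, h1]
  have eX : ellX (1, 0, 0) = 0 := by simp [ellX_apply]
  have eY : ellY (0, 1, 0) = 0 := by simp [ellY_apply]
  have kX := integral_mul_fieldD_reflect hw hwc hη hc h1 (1, 0, 0) ellX_vert x
  have kY := integral_mul_fieldD_reflect hw hwc hη hc h1 (0, 1, 0) ellY_vert x
  have kXX := integral_mul_fieldD_fieldD_reflect hw hwc hη hc ellX_vert eX x
  have kYY := integral_mul_fieldD_fieldD_reflect hw hwc hη hc ellY_vert eY x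
  have int : ∀ {Ψ : Heis → ℝ}, ContDiff ℝ (⊤ : ℕ∞) Ψ → HasCompactSupport Ψ →
      Integrable fun p => w p * Ψ p := fun hΨ hs =>
    (hw.continuous.mul hΨ.continuous).integrable_of_hasCompactSupport hs.mul_left
  have iX := int (cΦ.fieldD (1, 0, 0) ellX) (sΦ.fieldD _ _)
  have iY := int (cΦ.fieldD (0, 1, 0) ellY) (sΦ.fieldD _ _)
  have iXX := int ((cΦ.fieldD (1, 0, 0) ellX).fieldD (1, 0, 0) ellX) ((sΦ.fieldD _ _).fieldD _ _)
  have iYY := int ((cΦ.fieldD (0, 1, 0) ellY).fieldD (0, 1, 0) ellY) ((sΦ.fieldD _ _).fieldD _ _)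
  have split : ∫ p, w p * testOp P Q Φ p =
      -((∫ p, w p * fieldD (1, 0, 0) ellX (fieldD (1, 0, 0) ellX Φ) p) +
        ∫ p, w p * fieldD (0, 1, 0) ellY (fieldD (0, 1, 0) ellY Φ) p) +
      (2 * P * (∫ p, w p * fieldD (1, 0, 0) ellX Φ p) +
        2 * Q * ∫ p, w p * fieldD (0, 1, 0) ellY Φ p) := by
    have j1 : Integrable fun p => -(w p * fieldD (1, 0, 0) ellX (fieldD (1, 0, 0) ellX Φ) p +
        w p * fieldD (0, 1, 0) ellY (fieldD (0, 1, 0) ellY Φ) p) := (iXX.add iYY).neg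
    have j2 : Integrable fun p => 2 * P * (w p * fieldD (1, 0, 0) ellX Φ p) +
        2 * Q * (w p * fieldD (0, 1, 0) ellY Φ p) := (iX.const_mul _).add (iY.const_mul _)
    rw [← integral_add iXX iYY, ← integral_neg, ← integral_const_mul, ← integral_const_mul,
      ← integral_add (iX.const_mul _) (iY.const_mul _), ← integral_add j1 j2]
    congr 1
    funext p
    simp only [testOp, subLap_eq_fieldD, Xd_eq_fieldD, Yd_eq_fieldD]
    ring
  rw [split, kX, kY, kXX, kYY, iΦ] at key
  rw [fderiv_mollD hw.continuous hη hc, fderiv_mollD hw.continuous hη hc, eX, eY]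
  rw [← hP, ← hQ] at key
  linarith

theorem mollD_eq_zero {w η : Heis → ℝ} {c : ℝ} (h : WeakRiccati w)
    (hw : Differentiable ℝ w) (hwc : ∀ p, fderiv ℝ w p (0, 0, 1) = c)
    (hη : ContDiff ℝ (⊤ : ℕ∞) η) (hc : HasCompactSupport η) (h0 : ∀ t, 0 ≤ η t)
    (h1 : ∫ t, η t = 1) (x : Heis) :
    mollD w η c (1, 0, 0) ellX x = 0 ∧ mollD w η c (0, 1, 0) ellY x = 0 := by
  have top1 : (1 : WithTop ℕ∞) ≤ ((⊤ : ℕ∞) : WithTop ℕ∞) := by exact_mod_cast le_top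
  have cP := (contDiff_mollD hw.continuous hη hc c (1, 0, 0) ellX).of_le top1
  have cQ := (contDiff_mollD hw.continuous hη hc c (0, 1, 0) ellY).of_le top1
  let L : ℝ × ℝ →L[ℝ] Heis := (ContinuousLinearMap.fst ℝ ℝ ℝ).prod
    ((ContinuousLinearMap.snd ℝ ℝ ℝ).prod 0)
  have cι : ContDiff ℝ 1 fun z : ℝ × ℝ => L z + (0, 0, x.2.2) := L.contDiff.add contDiff_const
  have dι : ∀ {F : Heis → ℝ}, ContDiff ℝ 1 F → ∀ z e, fderiv ℝ (fun z => F (L z + (0, 0, x.2.2))) z e =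
      fderiv ℝ F (L z + (0, 0, x.2.2)) (L e) := by
    intro F hF z e
    have hF' := (hF.differentiable one_ne_zero (L z + (0, 0, x.2.2))).hasFDerivAt
    have := hF'.comp z (L.hasFDerivAt.add_const (0, 0, x.2.2))
    rw [show (fun z => F (L z + (0, 0, x.2.2))) = F ∘ fun z => L z + (0, 0, x.2.2) from rfl,
      this.fderiv]
    rfl
  have main := eq_zero_of_div_add_sq_le (cP.comp cι) (cQ.comp cι) (fun z => ?_) (x.1, x.2.1)
  · simpa [L] using main
  · have hr := h.fderiv_mollD_add_le hw hwc hη hc h0 h1 (L z + (0, 0, x.2.2))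
    simp only [Function.comp_def]
    rw [dι cP, dι cQ]
    simpa [L] using hr

theorem fderiv_mollify_eq_zero {w η : Heis → ℝ} {c : ℝ} (h : WeakRiccati w)
    (hw : Differentiable ℝ w) (hwc : ∀ p, fderiv ℝ w p (0, 0, 1) = c)
    (hη : ContDiff ℝ (⊤ : ℕ∞) η) (hc : HasCompactSupport η) (h0 : ∀ t, 0 ≤ η t)
    (h1 : ∫ t, η t = 1) (x : Heis) : fderiv ℝ (mollify w η) x = 0 := by
  have cW := contDiff_mollify hw.continuous hη hc
  have hz := mollD_eq_zero h hw hwc hη hc h0 h1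
  have c0 : c = 0 := by
    have e1 := fderiv_mollD hw.continuous hη hc c (1, 0, 0) ellX x (0, 1, 0)
    have e2 := fderiv_mollD hw.continuous hη hc c (0, 1, 0) ellY x (1, 0, 0)
    rw [show mollD w η c (1, 0, 0) ellX = fun _ => 0 from funext fun z => (hz z).1] at e1
    rw [show mollD w η c (0, 1, 0) ellY = fun _ => 0 from funext fun z => (hz z).2] at e2
    have hsym : IsSymmSndFDerivAt ℝ (mollify w η) x :=
      cW.contDiffAt.isSymmSndFDerivAt (by
        rw [minSmoothness_of_isRCLikeNormedField]
        exact WithTop.coe_le_coe.2 (le_top : (2 : ℕ∞) ≤ ⊤))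
    have hd : DifferentiableAt ℝ (fderiv ℝ (mollify w η)) x :=
      (cW.fderiv_right (m := (⊤ : ℕ∞)) (by simp)).differentiable (by simp) x
    have hs := hsym (0, 1, 0) (1, 0, 0)
    rw [fderiv_clm_apply hd (by fun_prop)] at e1 e2
    simp [ellX_apply, ellY_apply] at e1 e2
    linarith
  subst c0
  have z1 : fderiv ℝ (mollify w η) x (1, 0, 0) = 0 := by simpa [mollD] using (hz x).1
  have z2 : fderiv ℝ (mollify w η) x (0, 1, 0) = 0 := by simpa [mollD] using (hz x).2
  have z3 : fderiv ℝ (mollify w η) x (0, 0, 1) = 0 := by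
    have hinv : ∀ s : ℝ, mollify w η (x + s • ((0, 0, 1) : Heis)) = mollify w η x := by
      intro s
      simp only [mollify]
      rw [← integral_add_right_eq_self _ (s • ((0, 0, 1) : Heis))]
      simp_rw [apply_add_vert_of_fderiv_const hw hwc, add_sub_add_right_eq_sub, zero_mul, add_zero]
    rw [← (cW.differentiable (by simp) x).lineDeriv_eq_fderiv, lineDeriv, funext hinv, deriv_const]
  have hv : ∀ v : Heis, v = v.1 • ((1, 0, 0) : Heis) + v.2.1 • ((0, 1, 0) : Heis) +
      v.2.2 • ((0, 0, 1) : Heis) := fun v => by ext <;> simp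
  refine ContinuousLinearMap.ext fun v => ?_
  rw [hv v, map_add, map_add, map_smul, map_smul, map_smul, z1, z2, z3]
  simp

theorem WeakRiccati.eq_apply_zero {w : Heis → ℝ} {c : ℝ} (h : WeakRiccati w)
    (hw : Differentiable ℝ w) (hwc : ∀ p, fderiv ℝ w p (0, 0, 1) = c) (x : Heis) : w x = w 0 := by
  let φ : ℕ → ContDiffBump (0 : Heis) := fun n =>
    ⟨1 / (n + 1 : ℝ) / 2, 1 / (n + 1 : ℝ), by positivity, half_lt_self (by positivity)⟩
  have hφ : Tendsto (fun n => (φ n).rOut) atTop (𝓝 0) := tendsto_one_div_add_atTop_nhds_zero_nat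
  have lim := ContDiffBump.convolution_tendsto_right_of_continuous (μ := (volume : Measure Heis)) hφ
    hw.continuous
  have e : ∀ n z, ((φ n).normed volume ⋆[ContinuousLinearMap.lsmul ℝ ℝ, volume] w) z =
      mollify w ((φ n).normed volume) z := by
    intro n z
    rw [convolution_eq_swap, mollify]
    simp [mul_comm]
  have hconst : ∀ n, mollify w ((φ n).normed volume) x = mollify w ((φ n).normed volume) 0 := fun n =>
    is_const_of_fderiv_eq_zero ((contDiff_mollify hw.continuous (φ n).contDiff_normed
      (φ n).hasCompactSupport_normed).differentiable (by simp))
      (fderiv_mollify_eq_zero h hw hwc (φ n).contDiff_normed (φ n).hasCompactSupport_normed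
        (fun t => (φ n).nonneg_normed t) (φ n).integral_normed) x 0
  have l1 := lim x
  have l2 := lim 0
  simp_rw [e] at l1 l2
  simp_rw [hconst] at l1
  exact tendsto_nhds_unique l1 l2

theorem weakRiccati_of_gradb2_le {u f : Heis → ℝ} (hu : ContDiff ℝ (⊤ : ℕ∞) u) {K : Set Heis}
    (hK : IsCompact K) (hW : ∀ p ∉ K, gradb2 u p ≤ -(subLap u p)) (hf : ContDiff ℝ 1 f)
    (hi : Integrable f) {κ c : ℝ} {w : Heis → ℝ} (hw : Differentiable ℝ w)
    (huw : ∀ x, u x = w x + κ * ∫ y, log (rho y / rho (Hmul (Hinv y) x)) * f y)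
    (hwc : ∀ p, fderiv ℝ w p (0, 0, 1) = c) : WeakRiccati w := by
  intro Φ cΦ sΦ h0 b₁ b₂
  set Ψ := testOp b₁ b₂ Φ with hΨ
  have cΨ : Continuous Ψ := (contDiff_testOp cΦ b₁ b₂).continuous
  have sΨ : HasCompactSupport Ψ := hasCompactSupport_testOp sΦ b₁ b₂
  have iΨ : ∫ p, Ψ p = 0 := integral_testOp cΦ sΦ b₁ b₂
  have hpot := (differentiable_potential hf hi).continuous
  have lim := tendsto_integral_potential_vert_mul hf.continuous hi cΨ sΨ iΨ
  have e : ∀ n : ℕ, ∫ p, u (p + (n : ℝ) • ((0, 0, 1) : Heis)) * Ψ p = (∫ p, w p * Ψ p) +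
      κ * ∫ x, (∫ y, log (rho y / rho (Hmul (Hinv y)
        (x + (n : ℝ) • ((0, 0, 1) : Heis)))) * f y) * Ψ x := by
    intro n
    have i1 : Integrable fun p => w p * Ψ p :=
      (hw.continuous.mul cΨ).integrable_of_hasCompactSupport sΨ.mul_left
    have i2 : Integrable fun p => c * n * Ψ p :=
      (cΨ.integrable_of_hasCompactSupport sΨ).const_mul _
    have i3 : Integrable fun x => (∫ y, log (rho y / rho (Hmul (Hinv y)
        (x + (n : ℝ) • ((0, 0, 1) : Heis)))) * f y) * Ψ x :=
      ((hpot.comp (continuous_add_const _)).mul cΨ).integrable_of_hasCompactSupport sΨ.mul_left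
    have i4 : Integrable fun p => w p * Ψ p + c * n * Ψ p := i1.add i2
    have s : ∫ p, w p * Ψ p = ∫ p, w p * Ψ p + c * n * Ψ p := by
      rw [integral_add i1 i2, integral_const_mul, iΨ, mul_zero, add_zero]
    rw [s, ← integral_const_mul, ← integral_add i4 (i3.const_mul κ)]
    congr 1
    funext p
    rw [huw, apply_add_vert_of_fderiv_const hw hwc]
    ring
  have hn := eventually_integral_shift_mul_testOp_nonneg hu hK hW cΦ sΦ h0 b₁ b₂
  simp_rw [← hΨ, e] at hn
  refine ge_of_tendsto ?_ hn
  simpa using ((lim.const_mul κ).const_add (∫ p, w p * Ψ p)).add_const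
    ((b₁ ^ 2 + b₂ ^ 2) * ∫ p, Φ p)

end Rigidity

/-- a smooth conformal factor `u` on `ℍ¹` satisfying the pluriharmonic
equation `Δ_b²u + 16 T²u = 0`, with `Δ_b²u ∈ L¹`, nonnegative Webster scalar curvature
near infinity, and completeness of `e^u θ`, is a normal metric: `w = u − v` (with `v`
the potential of `Δ_b²u`, assumed to satisfy `Δ_b²w = 0` and `Tw` constant) is constant. -/
theorem normal_of_nonneg_Webster_at_infinity
    (u : Heis → ℝ) (hu : ContDiff ℝ (⊤ : ℕ∞) u)
    (hpde : ∀ p, subLap (subLap u) p + 16 * Td (Td u) p = 0)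
    (hL1 : Integrable (subLap (subLap u)) volume)
    (hWebster : ∃ K : Set Heis, IsCompact K ∧
      ∀ p ∉ K, gradb2 u p ≤ -(subLap u p))
    (hcomplete : ∀ (γ : ℝ → Heis) (a b : ℝ → ℝ),
      LocallyLipschitz γ →
      (∀ᵐ s ∂(volume.restrict (Set.Ici (0 : ℝ))),
        HasDerivAt γ
          (a s • ((1 : ℝ), (0 : ℝ), 2 * (γ s).2.1) + b s • ((0 : ℝ), (1 : ℝ), -(2 * (γ s).1))) s) →
      (∀ K : Set Heis, IsCompact K → ∃ S : ℝ, ∀ s ≥ S, γ s ∉ K) →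
      ∫⁻ s in Set.Ici (0 : ℝ),
        ENNReal.ofReal (Real.exp (u (γ s)) * Real.sqrt ((a s) ^ 2 + (b s) ^ 2)) = ⊤)
    (κ : ℝ) (v : Heis → ℝ)
    (hv : ∀ x, v x =
      κ * ∫ y, Real.log (rho y / rho (Hmul (Hinv y) x)) * subLap (subLap u) y)
    (hw1 : ∀ p, subLap (subLap (fun x => u x - v x)) p = 0)
    (hw2 : ∃ c : ℝ, ∀ p, Td (fun x => u x - v x) p = c) :
    ∃ C : ℝ, ∀ x, u x =
      κ * (∫ y, Real.log (rho y / rho (Hmul (Hinv y) x)) * subLap (subLap u) y) + C := by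
  obtain ⟨K, hK, hW⟩ := hWebster
  obtain ⟨c, hc⟩ := hw2
  have hf : ContDiff ℝ 1 (subLap (subLap u)) := hu.subLap.subLap.of_le (by exact_mod_cast le_top)
  have hw : Differentiable ℝ fun x => u x - v x := by
    simp_rw [hv]
    exact (hu.differentiable (by simp)).sub ((differentiable_potential hf hL1).const_mul κ)
  have hR : WeakRiccati fun x => u x - v x :=
    weakRiccati_of_gradb2_le hu hK hW hf hL1 hw (fun x => by rw [hv]; ring) hc
  refine ⟨u 0 - v 0, fun x => ?_⟩
  have h := hR.eq_apply_zero hw hc x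
  rw [← hv]
  linarith

end
end
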